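/- arXiv:2111.01361 — 6 statements merged into one kernel-verified Lean document; each statement's English description precedes it below -/
import Mathlib

section
/- (Interpreting maximizers.) Let (X,d) be a compact metric space, p ∈ [1,∞), ε ∈ (0,1), and μ, ν probability measures on X. If f ∈ C_b(X) maximizes the dual objective ∫ f dμ + ∫ f^c dν − ε·(sup_X f − inf_X f) for (1−ε)·W_p^ε(μ,ν)^p, then any positive measures μ' ≤ μ, ν' ≤ ν minimizing the primal problem for W_p^ε(μ,ν) satisfy supp(μ − μ') ⊆ argmax(f) and supp(ν − ν') ⊆ argmin(f). -/
open MeasureTheory ENNReal Filter Topology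

noncomputable section

variable {X : Type*} [MetricSpace X] [MeasurableSpace X] [BorelSpace X]

/-- The set of couplings of `μ` and `ν`. -/
def couplings (μ ν : Measure X) : Set (Measure (X × X)) :=
  {π | π.map Prod.fst = μ ∧ π.map Prod.snd = ν}

/-- The `p`-Wasserstein distance (`ℝ≥0∞`-valued); `p = ∞` uses the essential supremum. -/
def Wp (p : ℝ≥0∞) (μ ν : Measure X) : ℝ≥0∞ :=
  ⨅ π ∈ couplings μ ν, eLpNorm (fun z : X × X => dist z.1 z.2) p π

/-- The `ε`-outlier-robust `p`-Wasserstein distance. -/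
def RWp (p : ℝ≥0∞) (ε : ℝ) (μ ν : Measure X) : ℝ≥0∞ :=
  ⨅ (μ' : Measure X) (ν' : Measure X) (_ : μ' ≤ μ) (_ : ν' ≤ ν)
    (_ : (μ - μ') Set.univ ≤ ENNReal.ofReal ε)
    (_ : (ν - ν') Set.univ ≤ ENNReal.ofReal ε),
    Wp p ((μ' Set.univ)⁻¹ • μ') ((ν' Set.univ)⁻¹ • ν')

/-- The Huber `ε`-contamination ball around `μ`. -/
def huberBall (ε : ℝ) (μ : Measure X) : Set (Measure X) :=
  {μ' | ∃ α : Measure X, IsProbabilityMeasure α ∧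
    μ' = ENNReal.ofReal (1 - ε) • μ + ENNReal.ofReal ε • α}

/-- The `c`-transform of `f` with respect to the cost `c(x,y) = d(x,y)^p`. -/
def ctrans (p : ℝ) (f : X → ℝ) : X → ℝ := fun y => ⨅ x : X, (dist x y ^ p - f x)

/-- The (topological) support of a measure: points all of whose open neighborhoods have
positive mass. -/
def msupport (γ : Measure X) : Set X :=
  {x | ∀ U : Set X, IsOpen U → x ∈ U → 0 < γ U}

section helpers

lemma hb_aux {E : Type*} [AddCommGroup E] [Module ℝ E] (N : E → ℝ)
    (N_hom : ∀ c : ℝ, 0 < c → ∀ x, N (c • x) ≤ c * N x)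
    (N_add : ∀ x y, N (x + y) ≤ N x + N y) (N0 : N 0 = 0) (x₀ : E) :
    ∃ L : E →ₗ[ℝ] ℝ, L x₀ = N x₀ ∧ ∀ x, L x ≤ N x := by
  have hom : ∀ c : ℝ, 0 < c → ∀ x, N (c • x) = c * N x := by
    intro c hc x
    refine le_antisymm (N_hom c hc x) ?_
    have h := N_hom c⁻¹ (inv_pos.2 hc) (c • x)
    rw [smul_smul, inv_mul_cancel₀ hc.ne', one_smul] at h
    calc c * N x ≤ c * (c⁻¹ * N (c • x)) := by gcongr
      _ = N (c • x) := by field_simp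
  have H : ∀ c : ℝ, c • x₀ = 0 → c • N x₀ = 0 := by
    intro c hc
    rcases smul_eq_zero.1 hc with h | h
    · simp [h]
    · simp [h, N0]
  obtain ⟨g, hg1, hg2⟩ := exists_extension_of_le_sublinear
    (LinearPMap.mkSpanSingleton' x₀ (N x₀) H) N hom N_add (by
      rintro ⟨x, hx⟩
      obtain ⟨c, rfl⟩ := Submodule.mem_span_singleton.1 hx
      rw [LinearPMap.mkSpanSingleton'_apply]
      simp only [smul_eq_mul, RingHom.id_apply]
      rcases lt_trichotomy c 0 with h | h | h
      · have h1 := hom (-c) (by linarith) x₀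
        have h2 := N_add (c • x₀) ((-c) • x₀)
        rw [← add_smul, add_neg_cancel, zero_smul, N0] at h2
        linarith
      · simp [h, N0]
      · exact (hom c h x₀).ge)
  refine ⟨g, ?_, hg2⟩
  have h := hg1 ⟨x₀, Submodule.mem_span_singleton_self x₀⟩
  simpa using h.trans (LinearPMap.mkSpanSingleton'_apply_self x₀ (N x₀) H _)

lemma riesz_aux {Z : Type*} [TopologicalSpace Z] [T2Space Z] [CompactSpace Z]
    [MeasurableSpace Z] [BorelSpace Z] (L : C(Z, ℝ) →ₗ[ℝ] ℝ)
    (hL : ∀ h : C(Z, ℝ), (∀ z, 0 ≤ h z) → 0 ≤ L h) :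
    ∃ π : Measure Z, IsFiniteMeasure π ∧ ∀ h : C(Z, ℝ), ∫ z, h z ∂π = L h := by
  let Λ : CompactlySupportedContinuousMap Z ℝ →ₚ[ℝ] ℝ := PositiveLinearMap.mk₀
    { toFun := fun h => L (h : C(Z, ℝ))
      map_add' := fun a b => L.map_add (a : C(Z, ℝ)) b
      map_smul' := fun c a => L.map_smul c (a : C(Z, ℝ)) }
    (fun a ha => hL _ (fun z => ha z))
  refine ⟨RealRMK.rieszMeasure Λ, ?_, fun h => ?_⟩
  · exact ⟨isCompact_univ.measure_lt_top⟩
  · exact RealRMK.integral_rieszMeasure Λ (CompactlySupportedContinuousMap.continuousMapEquiv h)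

lemma le_of_integral_aux {Y : Type*} [MetricSpace Y] [MeasurableSpace Y] [BorelSpace Y]
    (μ ν : Measure Y) [IsFiniteMeasure μ] [IsFiniteMeasure ν]
    (h : ∀ g : C(Y, ℝ), (∀ y, 0 ≤ g y) → ∫ y, g y ∂μ ≤ ∫ y, g y ∂ν) : μ ≤ ν := by
  have hcl : ∀ F : Set Y, IsClosed F → μ F ≤ ν F := by
    intro F hF
    have h1 := tendsto_integral_thickenedIndicator_of_isClosed μ hF
      (δs := fun n : ℕ => 1 / ((n : ℝ) + 1)) (fun n => by positivity)
      tendsto_one_div_add_atTop_nhds_zero_nat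
    have h2 := tendsto_integral_thickenedIndicator_of_isClosed ν hF
      (δs := fun n : ℕ => 1 / ((n : ℝ) + 1)) (fun n => by positivity)
      tendsto_one_div_add_atTop_nhds_zero_nat
    have h3 := le_of_tendsto_of_tendsto' h1 h2 (fun n =>
      h ⟨fun y => ((thickenedIndicator (δ := 1 / ((n : ℝ) + 1)) (by positivity) F y : NNReal) : ℝ),
        by fun_prop⟩ (fun y => by simp))
    exact (ENNReal.toReal_le_toReal (measure_ne_top _ _) (measure_ne_top _ _)).1 h3
  rw [Measure.le_iff]
  intro s hs
  rw [hs.measure_eq_iSup_isClosed_of_ne_top (measure_ne_top _ _)]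
  exact iSup_le fun K => iSup_le fun hK => iSup_le fun hKc => (hcl K hKc).trans (measure_mono hK)

/-- one-sided functional -/
def Jf {Y : Type*} [TopologicalSpace Y] [MeasurableSpace Y] (ε : ℝ) (μ : Measure Y)
    (φ : C(Y, ℝ)) : ℝ := ∫ y, φ y ∂μ - ε * ⨅ y, φ y

section J
variable {Y : Type*} [MetricSpace Y] [CompactSpace Y] [Nonempty Y] [MeasurableSpace Y]
  [BorelSpace Y] (ε : ℝ) (μ : Measure Y) [IsProbabilityMeasure μ]

lemma cint (μ : Measure Y) [IsFiniteMeasure μ] (φ : C(Y, ℝ)) : Integrable (fun y => φ y) μ :=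
  φ.continuous.integrable_of_hasCompactSupport (HasCompactSupport.of_compactSpace _)

lemma cbdd (φ : C(Y, ℝ)) : BddBelow (Set.range fun y => φ y) :=
  (isCompact_range φ.continuous).bddBelow

lemma Jf_add (hε : 0 ≤ ε) (φ ψ : C(Y, ℝ)) : Jf ε μ (φ + ψ) ≤ Jf ε μ φ + Jf ε μ ψ := by
  unfold Jf
  have h1 : ∫ y, (φ + ψ) y ∂μ = ∫ y, φ y ∂μ + ∫ y, ψ y ∂μ :=
    integral_add (cint μ φ) (cint μ ψ)
  have h2 : (⨅ y, φ y) + (⨅ y, ψ y) ≤ ⨅ y, (φ + ψ) y :=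
    le_ciInf fun y => add_le_add (ciInf_le (cbdd φ) y) (ciInf_le (cbdd ψ) y)
  rw [h1]
  nlinarith

lemma Jf_smul (c : ℝ) (hc : 0 ≤ c) (φ : C(Y, ℝ)) : Jf ε μ (c • φ) = c * Jf ε μ φ := by
  unfold Jf
  have h1 : ∫ y, (c • φ) y ∂μ = c * ∫ y, φ y ∂μ := integral_const_mul c _
  have h2 : (⨅ y, (c • φ) y) = c * ⨅ y, φ y := (Real.mul_iInf_of_nonneg hc _).symm
  rw [h1, h2]; ring

lemma Jf_ge (φ : C(Y, ℝ)) : (1 - ε) * (⨅ y, φ y) ≤ Jf ε μ φ := by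
  unfold Jf
  have : ∫ _y, (⨅ y, φ y) ∂μ ≤ ∫ y, φ y ∂μ :=
    integral_mono (integrable_const _) (cint μ φ) (fun y => ciInf_le (cbdd φ) y)
  simp only [integral_const, probReal_univ, one_smul] at this
  linarith

lemma Jf_const (k : ℝ) : Jf ε μ (ContinuousMap.const Y k) = (1 - ε) * k := by
  simp [Jf]; ring

lemma Jf_le (hε : 0 ≤ ε) (φ : C(Y, ℝ)) (h : ∀ y, 0 ≤ φ y) : Jf ε μ φ ≤ ∫ y, φ y ∂μ := by
  unfold Jf
  have : 0 ≤ ⨅ y, φ y := le_ciInf h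
  nlinarith [mul_nonneg hε this]

lemma primal_aux (ν : Measure Y) [IsProbabilityMeasure ν] (hε0 : 0 ≤ ε) (hε1 : ε < 1)
    (c : C(Y × Y, ℝ)) (M : ℝ)
    (hM : ∀ φ ψ : C(Y, ℝ), (∀ x y, - c (x, y) ≤ φ x + ψ y) → -M ≤ Jf ε μ φ + Jf ε ν ψ) :
    ∃ π : Measure (Y × Y), IsFiniteMeasure π ∧ π.map Prod.fst ≤ μ ∧ π.map Prod.snd ≤ ν ∧
      π Set.univ = ENNReal.ofReal (1 - ε) ∧ ∫ z, c z ∂π ≤ M := by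
  let T : C(Y × Y, ℝ) → Set ℝ := fun h => {r | ∃ φ ψ : C(Y, ℝ),
    (∀ x y, h (x, y) ≤ φ x + ψ y) ∧ r = Jf ε μ φ + Jf ε ν ψ}
  let N : C(Y × Y, ℝ) → ℝ := fun h => sInf (T h)
  have hlow : ∀ h : C(Y × Y, ℝ), ∀ r ∈ T h, (1 - ε) * (⨅ z, h z) ≤ r := by
    rintro h r ⟨φ, ψ, hh, rfl⟩
    have h1 : (⨅ z, h z) ≤ (⨅ y, φ y) + ⨅ y, ψ y := by
      have h2 : ∀ y, (⨅ z, h z) - ψ y ≤ ⨅ x, φ x := fun y => le_ciInf fun x => by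
        have := ciInf_le (cbdd h) (x, y)
        have := hh x y
        linarith
      have h3 : (⨅ z, h z) - (⨅ x, φ x) ≤ ⨅ y, ψ y := le_ciInf fun y => by
        have := h2 y
        linarith
      linarith
    have := Jf_ge ε μ φ
    have := Jf_ge ε ν ψ
    nlinarith
  have hbdd : ∀ h, BddBelow (T h) := fun h => ⟨_, hlow h⟩
  have hne : ∀ h, (T h).Nonempty := by
    intro h
    refine ⟨_, ContinuousMap.const Y ‖h‖, ContinuousMap.const Y 0, fun x y => ?_, rfl⟩
    have := h.norm_coe_le_norm (x, y)
    simpa using (le_abs_self _).trans this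
  have hle : ∀ (h : C(Y × Y, ℝ)) (φ ψ : C(Y, ℝ)), (∀ x y, h (x, y) ≤ φ x + ψ y) →
      N h ≤ Jf ε μ φ + Jf ε ν ψ := fun h φ ψ hh => csInf_le (hbdd h) ⟨φ, ψ, hh, rfl⟩
  have J0 : ∀ (ρ : Measure Y) [IsProbabilityMeasure ρ], Jf ε ρ 0 = 0 := by
    intro ρ _
    have := Jf_const ε ρ 0
    simpa using this
  obtain ⟨L, hL0, hL⟩ := hb_aux N
    (by
      intro k hk h
      have : N (k • h) / k ≤ N h := by
        refine le_csInf (hne h) ?_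
        rintro r ⟨φ, ψ, hh, rfl⟩
        rw [div_le_iff₀' hk, mul_add, ← Jf_smul ε μ k hk.le, ← Jf_smul ε ν k hk.le]
        refine hle _ _ _ fun x y => ?_
        have := mul_le_mul_of_nonneg_left (hh x y) hk.le
        simpa [mul_add] using this
      rwa [div_le_iff₀' hk] at this)
    (by
      intro a b
      have : N (a + b) - N b ≤ N a := by
        refine le_csInf (hne a) ?_
        rintro r ⟨φ, ψ, hh, rfl⟩
        have : N (a + b) - (Jf ε μ φ + Jf ε ν ψ) ≤ N b := by
          refine le_csInf (hne b) ?_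
          rintro r ⟨φ', ψ', hh', rfl⟩
          have h1 := hle (a + b) (φ + φ') (ψ + ψ') (fun x y => by
            have := hh x y
            have := hh' x y
            simp only [ContinuousMap.add_apply]
            linarith)
          have := Jf_add ε μ hε0 φ φ'
          have := Jf_add ε ν hε0 ψ ψ'
          linarith
        linarith
      linarith)
    (by
      refine le_antisymm ?_ ?_
      · have := hle 0 0 0 (by simp)
        simpa [J0] using this
      · refine le_csInf (hne 0) fun r hr => ?_
        simpa using hlow 0 r hr)
    (-c)
  obtain ⟨π, hπ, hπL⟩ := riesz_aux L (by
    intro h hh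
    have h1 := hL (-h)
    have h2 := hle (-h) 0 0 (by simpa using fun x y => hh (x, y))
    rw [J0, J0, map_neg] at *
    linarith)
  have hmass : π Set.univ = ENNReal.ofReal (1 - ε) := by
    have h0 : ∫ z, (ContinuousMap.const (Y × Y) (1 : ℝ)) z ∂π = π.real Set.univ := by simp
    have h1 := hL (ContinuousMap.const _ 1)
    have h2 := hle (ContinuousMap.const _ 1) (ContinuousMap.const _ 1) (ContinuousMap.const _ 0)
      (by simp)
    have h3 := hL (-ContinuousMap.const _ 1)
    have h4 := hle (-ContinuousMap.const _ 1) (ContinuousMap.const _ (-1)) (ContinuousMap.const _ 0)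
      (by simp)
    rw [map_neg] at h3
    rw [Jf_const, Jf_const] at h2 h4
    rw [hπL] at h0
    have : π.real Set.univ = 1 - ε := by linarith
    rw [← this, ofReal_measureReal]
  refine ⟨π, hπ, ?_, ?_, hmass, ?_⟩
  · refine le_of_integral_aux _ _ fun g hg => ?_
    rw [integral_map (by fun_prop) (by fun_prop)]
    have h1 := hπL (g.comp ⟨Prod.fst, continuous_fst⟩)
    have h2 := hL (g.comp ⟨Prod.fst, continuous_fst⟩)
    have h3 := hle (g.comp ⟨Prod.fst, continuous_fst⟩) g 0 (by simp)
    have h4 := Jf_le ε μ hε0 g hg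
    rw [J0] at h3
    simp only [ContinuousMap.comp_apply, ContinuousMap.coe_mk] at h1
    linarith
  · refine le_of_integral_aux _ _ fun g hg => ?_
    rw [integral_map (by fun_prop) (by fun_prop)]
    have h1 := hπL (g.comp ⟨Prod.snd, continuous_snd⟩)
    have h2 := hL (g.comp ⟨Prod.snd, continuous_snd⟩)
    have h3 := hle (g.comp ⟨Prod.snd, continuous_snd⟩) 0 g (by simp)
    have h4 := Jf_le ε ν hε0 g hg
    rw [J0] at h3
    simp only [ContinuousMap.comp_apply, ContinuousMap.coe_mk] at h1
    linarith
  · rw [hπL c]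
    have h1 : -M ≤ N (-c) := by
      refine le_csInf (hne _) ?_
      rintro r ⟨φ, ψ, hh, rfl⟩
      exact hM φ ψ hh
    rw [map_neg] at hL0
    linarith

end J

section K
variable {Y : Type*} [MetricSpace Y] [CompactSpace Y] [Nonempty Y] [MeasurableSpace Y]
  [BorelSpace Y]

/-- the cost as a continuous map -/
def costC (Y : Type*) [MetricSpace Y] (p : ℝ) (hp : 1 ≤ p) : C(Y × Y, ℝ) :=
  ⟨fun z => dist z.1 z.2 ^ p, continuous_dist.rpow_const fun _ => Or.inr (by linarith)⟩

lemma ctrans_cont (p : ℝ) (hp : 1 ≤ p) (f : C(Y, ℝ)) : Continuous (ctrans p f) := by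
  have h := IsCompact.continuous_sInf (f := fun (y x : Y) => dist x y ^ p - f x)
    (isCompact_univ (X := Y)) (by
      refine Continuous.sub ?_ (by fun_prop)
      exact Continuous.rpow_const (by fun_prop) fun _ => Or.inr (by linarith))
  convert h using 2 with y
  simp [ctrans, iInf]

lemma ctrans_le (p : ℝ) (hp : 1 ≤ p) (f : C(Y, ℝ)) (x y : Y) :
    ctrans p f y ≤ dist x y ^ p - f x := by
  have hc : Continuous fun x => dist x y ^ p - f x := by
    refine Continuous.sub ?_ (by fun_prop)
    exact Continuous.rpow_const (by fun_prop) fun _ => Or.inr (by linarith)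
  exact ciInf_le (cbdd ⟨_, hc⟩) x

lemma le_ctrans (p : ℝ) (f : Y → ℝ) (y : Y) (r : ℝ) (h : ∀ x, r ≤ dist x y ^ p - f x) :
    r ≤ ctrans p f y := le_ciInf h

lemma dual_aux (p : ℝ) (hp : 1 ≤ p) (ε : ℝ) (hε0 : 0 < ε) (hε1 : ε < 1)
    (μ ν : Measure Y) [IsProbabilityMeasure μ] [IsProbabilityMeasure ν] (M : ℝ)
    (hmax : ∀ g : C(Y, ℝ),
      ∫ x, g x ∂μ + ∫ y, ctrans p g y ∂ν - ε * ((⨆ x, g x) - ⨅ x, g x) ≤ M)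
    (φ ψ : C(Y, ℝ)) (h : ∀ x y, - costC Y p hp (x, y) ≤ φ x + ψ y) :
    -M ≤ Jf ε μ φ + Jf ε ν ψ := by
  have h : ∀ x y, - (dist x y ^ p) ≤ φ x + ψ y := h
  set a := ⨅ x, φ x with ha
  set b := ⨅ x, ψ x with hb
  rcases lt_or_ge 0 (a + b) with hab | hab
  · have h1 : (1 - ε) * a ≤ _ := Jf_ge ε μ φ
    have h2 : (1 - ε) * b ≤ _ := Jf_ge ε ν ψ
    have h3 := hmax 0
    have h4 : 0 ≤ ∫ y, ctrans p (0 : C(Y, ℝ)) y ∂ν := by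
      refine integral_nonneg fun y => ?_
      refine le_ctrans p _ y _ fun x => ?_
      have : 0 ≤ dist x y ^ p := by positivity
      simpa using this
    simp only [ContinuousMap.zero_apply, integral_zero, ciSup_const, ciInf_const] at h3
    nlinarith
  · let f₁ : C(Y, ℝ) := ⟨fun x => min (ctrans p (-ψ : C(Y, ℝ)) x) (-a),
      (ctrans_cont p hp _).min continuous_const⟩
    have hf₁ : ∀ x, f₁ x = min (ctrans p (-ψ : C(Y, ℝ)) x) (-a) := fun x => rfl
    have h1 := hmax f₁
    have e1 : ∫ x, -φ x ∂μ ≤ ∫ x, f₁ x ∂μ := by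
      refine integral_mono (cint μ (-φ)) (cint μ f₁) fun x => ?_
      change -φ x ≤ f₁ x
      rw [hf₁]
      refine le_min (le_ctrans p _ x _ fun y => ?_) (neg_le_neg (ciInf_le (cbdd φ) x))
      have := h x y
      rw [dist_comm] at this
      simp only [ContinuousMap.neg_apply]
      linarith
    have e2 : ∫ x, -ψ x ∂ν ≤ ∫ x, ctrans p f₁ x ∂ν := by
      refine integral_mono (cint ν (-ψ)) (cint ν ⟨_, ctrans_cont p hp f₁⟩) fun y => ?_
      refine le_ctrans p _ y _ fun x => ?_
      have h2 := ctrans_le p hp (-ψ) y x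
      have h3 : f₁ x ≤ _ := min_le_left _ _
      rw [dist_comm] at h2
      simp only [ContinuousMap.neg_apply] at *
      linarith
    have e3 : (⨆ x, f₁ x) ≤ -a := ciSup_le fun x => min_le_right _ _
    have e4 : b ≤ ⨅ x, f₁ x := by
      refine le_ciInf fun x => ?_
      rw [hf₁]
      refine le_min (le_ctrans p _ x _ fun y => ?_) (by linarith)
      have : 0 ≤ dist y x ^ p := by positivity
      have := ciInf_le (cbdd ψ) y
      simp only [ContinuousMap.neg_apply]
      linarith
    rw [integral_neg] at e1 e2
    unfold Jf
    rw [← ha, ← hb]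
    nlinarith

lemma eLp_aux (p : ℝ) (hp : 1 ≤ p) (π : Measure (Y × Y)) [IsFiniteMeasure π] :
    eLpNorm (fun z : Y × Y => dist z.1 z.2) (ENNReal.ofReal p) π
      = ENNReal.ofReal ((∫ z, costC Y p hp z ∂π) ^ p⁻¹) := by
  have hm : MemLp (fun z : Y × Y => dist z.1 z.2) (ENNReal.ofReal p) π :=
    (continuous_dist (α := Y)).memLp_of_hasCompactSupport (HasCompactSupport.of_compactSpace _)
  rw [hm.eLpNorm_eq_integral_rpow_norm (by simp; linarith) (by simp)]
  rw [ENNReal.toReal_ofReal (by linarith)]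
  simp [costC]

lemma sub_mass_aux (ε : ℝ) (hε1 : ε < 1)
    (μ μ' : Measure Y) [IsProbabilityMeasure μ] (h : μ' ≤ μ)
    (hm : μ' Set.univ = ENNReal.ofReal (1 - ε)) : (μ - μ') Set.univ ≤ ENNReal.ofReal ε := by
  have : IsFiniteMeasure μ' := isFiniteMeasure_of_le μ h
  rw [Measure.sub_apply MeasurableSet.univ h, hm, measure_univ]
  rw [← ENNReal.ofReal_one, ← ENNReal.ofReal_sub _ (by linarith)]
  simp

lemma RWp_le_aux (p : ℝ) (hp : 1 ≤ p) (ε : ℝ) (hε0 : 0 < ε) (hε1 : ε < 1)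
    (μ ν : Measure Y) [IsProbabilityMeasure μ] [IsProbabilityMeasure ν] (M : ℝ)
    (hmax : ∀ g : C(Y, ℝ),
      ∫ x, g x ∂μ + ∫ y, ctrans p g y ∂ν - ε * ((⨆ x, g x) - ⨅ x, g x) ≤ M) :
    0 ≤ M ∧ RWp (ENNReal.ofReal p) ε μ ν ≤ ENNReal.ofReal ((M / (1 - ε)) ^ p⁻¹) := by
  obtain ⟨π, hπ, h1, h2, h3, h4⟩ := primal_aux ε μ ν hε0.le hε1 (costC Y p hp) M
    (dual_aux p hp ε hε0 hε1 μ ν M hmax)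
  have hc0 : 0 ≤ ∫ z, costC Y p hp z ∂π := integral_nonneg fun z => by
    change 0 ≤ dist z.1 z.2 ^ p
    positivity
  refine ⟨hc0.trans h4, ?_⟩
  have m1 : π.map Prod.fst Set.univ = ENNReal.ofReal (1 - ε) := by
    rw [Measure.map_apply measurable_fst MeasurableSet.univ]; simpa using h3
  have m2 : π.map Prod.snd Set.univ = ENNReal.ofReal (1 - ε) := by
    rw [Measure.map_apply measurable_snd MeasurableSet.univ]; simpa using h3
  have hne : ENNReal.ofReal (1 - ε) ≠ 0 := by simp; linarith
  unfold RWp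
  refine (iInf_le _ (π.map Prod.fst)).trans <| (iInf_le _ (π.map Prod.snd)).trans <|
    (iInf_le _ h1).trans <| (iInf_le _ h2).trans <|
    (iInf_le _ (sub_mass_aux ε hε1 μ _ h1 m1)).trans <|
    (iInf_le _ (sub_mass_aux ε hε1 ν _ h2 m2)).trans ?_
  rw [m1, m2]
  unfold Wp
  refine (iInf₂_le ((ENNReal.ofReal (1 - ε))⁻¹ • π)
    ⟨by rw [Measure.map_smul], by rw [Measure.map_smul]⟩).trans ?_
  · have : IsFiniteMeasure ((ENNReal.ofReal (1 - ε))⁻¹ • π) :=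
      π.smul_finite (ENNReal.inv_ne_top.2 hne)
    rw [eLp_aux p hp]
    refine ENNReal.ofReal_le_ofReal ?_
    rw [integral_smul_measure, ENNReal.toReal_inv, ENNReal.toReal_ofReal (by linarith), smul_eq_mul]
    have : 0 < 1 - ε := by linarith
    refine Real.rpow_le_rpow (by positivity) ?_ (by positivity)
    rw [div_eq_inv_mul]
    gcongr

lemma coupling_aux (p : ℝ) (hp : 1 ≤ p) (α β : Measure Y) [IsProbabilityMeasure α]
    [IsProbabilityMeasure β] (f : C(Y, ℝ)) (K : ℝ) (hK : 0 ≤ K)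
    (h : Wp (ENNReal.ofReal p) α β ≤ ENNReal.ofReal (K ^ p⁻¹)) :
    ∫ x, f x ∂α + ∫ y, ctrans p f y ∂β ≤ K := by
  have hp0 : 0 < p⁻¹ := by positivity
  refine le_of_forall_pos_le_add fun δ hδ => ?_
  have hlt : Wp (ENNReal.ofReal p) α β < ENNReal.ofReal ((K + δ) ^ p⁻¹) := by
    refine h.trans_lt ?_
    rw [ENNReal.ofReal_lt_ofReal_iff (by positivity)]
    exact Real.rpow_lt_rpow hK (by linarith) hp0
  unfold Wp at hlt
  simp only [iInf_lt_iff] at hlt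
  obtain ⟨ρ, ⟨r1, r2⟩, hρ⟩ := hlt
  have hfin : IsFiniteMeasure ρ := by
    constructor
    have : ρ.map Prod.fst Set.univ = 1 := by rw [r1]; simp
    rw [Measure.map_apply measurable_fst MeasurableSet.univ] at this
    simp only [Set.preimage_univ] at this
    simp [this]
  rw [eLp_aux p hp, ENNReal.ofReal_lt_ofReal_iff (by positivity)] at hρ
  have hc0 : 0 ≤ ∫ z, costC Y p hp z ∂ρ := integral_nonneg fun z => by
    change 0 ≤ dist z.1 z.2 ^ p
    positivity
  rw [Real.rpow_lt_rpow_iff hc0 (by positivity) hp0] at hρ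
  have hfc := ctrans_cont p hp f
  let F1 : C(Y × Y, ℝ) := ⟨fun z => f z.1, by fun_prop⟩
  let F2 : C(Y × Y, ℝ) := ⟨fun z => ctrans p f z.2, by fun_prop⟩
  have i1 : ∫ x, f x ∂α = ∫ z, F1 z ∂ρ := by
    rw [← r1, integral_map (by fun_prop) (by fun_prop)]; rfl
  have i2 : ∫ y, ctrans p f y ∂β = ∫ z, F2 z ∂ρ := by
    rw [← r2, integral_map (by fun_prop) hfc.aestronglyMeasurable]; rfl
  rw [i1, i2, ← integral_add (cint ρ F1) (cint ρ F2)]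
  refine le_trans (integral_mono ((cint ρ F1).add (cint ρ F2)) (cint ρ (costC Y p hp)) ?_) hρ.le
  intro z
  have := ctrans_le p hp f z.1 z.2
  change f z.1 + ctrans p f z.2 ≤ dist z.1 z.2 ^ p
  linarith

lemma mass_aux (ε : ℝ) (hε0 : 0 < ε) (hε1 : ε < 1) (μ μ' : Measure Y) [IsProbabilityMeasure μ]
    (h : μ' ≤ μ) (hm : (μ - μ') Set.univ ≤ ENNReal.ofReal ε) : 1 - ε ≤ (μ' Set.univ).toReal := by
  have : IsFiniteMeasure μ' := isFiniteMeasure_of_le μ h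
  rw [Measure.sub_apply MeasurableSet.univ h, measure_univ] at hm
  have h1 := tsub_le_iff_right.1 hm
  have h2 := ENNReal.toReal_mono (by simp) h1
  rw [ENNReal.toReal_add (by simp) (by simp), ENNReal.toReal_ofReal hε0.le] at h2
  simp at h2
  linarith

/-- If `F ≥ 0` is continuous and has zero integral then it vanishes on the support. -/
lemma supp_aux (γ : Measure Y) [IsFiniteMeasure γ] (F : C(Y, ℝ)) (hF : ∀ y, 0 ≤ F y)
    (h : ∫ y, F y ∂γ ≤ 0) (x : Y) (hx : x ∈ msupport γ) : F x = 0 := by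
  by_contra hne
  have h0 : ∫ y, F y ∂γ = 0 := le_antisymm h (integral_nonneg hF)
  rw [integral_eq_zero_iff_of_nonneg hF (cint γ F)] at h0
  have h1 := hx {y | F y ≠ 0} (isOpen_ne_fun F.continuous continuous_const) hne
  exact h1.ne' h0

end K
end helpers

/-- interpreting maximizers: if `f` maximizes the dual objective
`∫ f dμ + ∫ f^c dν − ε(sup f − inf f)`, then any primal minimizers `μ' ≤ μ`, `ν' ≤ ν`
for `W_p^ε(μ,ν)` satisfy `supp(μ − μ') ⊆ argmax f` and `supp(ν − ν') ⊆ argmin f`. -/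
theorem dual_maximizer_interpretation {X : Type*} [MetricSpace X] [CompactSpace X]
    [Nonempty X] [MeasurableSpace X] [BorelSpace X]
    (p : ℝ) (hp : 1 ≤ p) (ε : ℝ) (hε0 : 0 < ε) (hε1 : ε < 1)
    (μ ν : Measure X) [IsProbabilityMeasure μ] [IsProbabilityMeasure ν]
    (f : C(X, ℝ))
    (hmax : ∀ g : C(X, ℝ),
      ∫ x, g x ∂μ + ∫ y, ctrans p g y ∂ν - ε * ((⨆ x, g x) - ⨅ x, g x)
        ≤ ∫ x, f x ∂μ + ∫ y, ctrans p f y ∂ν - ε * ((⨆ x, f x) - ⨅ x, f x))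
    (μ' ν' : Measure X) (hμ' : μ' ≤ μ) (hν' : ν' ≤ ν)
    (hμ'tv : (μ - μ') Set.univ ≤ ENNReal.ofReal ε)
    (hν'tv : (ν - ν') Set.univ ≤ ENNReal.ofReal ε)
    (hopt : Wp (ENNReal.ofReal p) ((μ' Set.univ)⁻¹ • μ') ((ν' Set.univ)⁻¹ • ν')
      = RWp (ENNReal.ofReal p) ε μ ν) :
    msupport (μ - μ') ⊆ {x | ∀ z : X, f z ≤ f x} ∧
    msupport (ν - ν') ⊆ {x | ∀ z : X, f x ≤ f z} := by
  set M := ∫ x, f x ∂μ + ∫ y, ctrans p f y ∂ν - ε * ((⨆ x, f x) - ⨅ x, f x) with hM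
  obtain ⟨hM0, hR⟩ := RWp_le_aux p hp ε hε0 hε1 μ ν M hmax
  have hfμ : IsFiniteMeasure μ' := isFiniteMeasure_of_le μ hμ'
  have hfν : IsFiniteMeasure ν' := isFiniteMeasure_of_le ν hν'
  have hfτ : IsFiniteMeasure (μ - μ') := isFiniteMeasure_of_le μ Measure.sub_le
  have hfτ' : IsFiniteMeasure (ν - ν') := isFiniteMeasure_of_le ν Measure.sub_le
  have hε' : 0 < 1 - ε := by linarith
  have ma := mass_aux ε hε0 hε1 μ μ' hμ' hμ'tv
  have mb := mass_aux ε hε0 hε1 ν ν' hν' hν'tv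
  have hne : NeZero μ' := ⟨by rintro rfl; simp at ma; linarith⟩
  have hne' : NeZero ν' := ⟨by rintro rfl; simp at mb; linarith⟩
  have key := coupling_aux p hp ((μ' Set.univ)⁻¹ • μ') ((ν' Set.univ)⁻¹ • ν') f (M / (1 - ε))
    (by positivity) (hopt.trans_le hR)
  set S := ⨆ x, f x with hS
  set I := ⨅ x, f x with hI
  have hfS : ∀ x, f x ≤ S := fun x => le_ciSup (isCompact_range f.continuous).bddAbove x
  have hfI : ∀ x, I ≤ f x := fun x => ciInf_le (cbdd f) x
  have hcc := ctrans_cont p hp f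
  let fc : C(X, ℝ) := ⟨ctrans p f, hcc⟩
  have hfc : ∀ y, fc y ≤ - f y := by
    intro y
    have := ctrans_le p hp f y y
    rw [dist_self, Real.zero_rpow (by linarith)] at this
    change ctrans p f y ≤ _
    linarith
  let F : C(X, ℝ) := ContinuousMap.const X S - f
  let G : C(X, ℝ) := ContinuousMap.const X (-I) - fc
  have hF0 : ∀ x, 0 ≤ F x := fun x => sub_nonneg.2 (hfS x)
  have hG0 : ∀ x, 0 ≤ G x := fun x => sub_nonneg.2 ((hfc x).trans (neg_le_neg (hfI x)))
  have iF : ∀ (ρ : Measure X) [IsFiniteMeasure ρ],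
      ∫ x, f x ∂ρ = S * (ρ Set.univ).toReal - ∫ x, F x ∂ρ := by
    intro ρ _
    have : ∫ x, F x ∂ρ = ∫ x, S ∂ρ - ∫ x, f x ∂ρ :=
      integral_sub (integrable_const _) (cint ρ f)
    rw [this, integral_const, smul_eq_mul, Measure.real]
    ring
  have iG : ∀ (ρ : Measure X) [IsFiniteMeasure ρ],
      ∫ x, ctrans p f x ∂ρ = -I * (ρ Set.univ).toReal - ∫ x, G x ∂ρ := by
    intro ρ _
    have : ∫ x, G x ∂ρ = ∫ x, -I ∂ρ - ∫ x, ctrans p f x ∂ρ :=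
      integral_sub (integrable_const _) (cint ρ fc)
    rw [this, integral_const, smul_eq_mul, Measure.real]
    ring
  have dF : ∫ x, F x ∂μ = ∫ x, F x ∂(μ - μ') + ∫ x, F x ∂μ' := by
    rw [← integral_add_measure (cint _ F) (cint _ F), Measure.sub_add_cancel_of_le hμ']
  have dG : ∫ x, G x ∂ν = ∫ x, G x ∂(ν - ν') + ∫ x, G x ∂ν' := by
    rw [← integral_add_measure (cint _ G) (cint _ G), Measure.sub_add_cancel_of_le hν']
  have nF : 0 ≤ ∫ x, F x ∂μ' := integral_nonneg hF0
  have nG : 0 ≤ ∫ x, G x ∂ν' := integral_nonneg hG0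
  have nF2 : 0 ≤ ∫ x, F x ∂(μ - μ') := integral_nonneg hF0
  have nG2 : 0 ≤ ∫ x, G x ∂(ν - ν') := integral_nonneg hG0
  rw [iF, iG, integral_smul_measure, integral_smul_measure] at key
  rw [iF μ, iG ν, dF, dG] at hM
  simp only [measure_univ, ENNReal.toReal_one, mul_one, ENNReal.toReal_inv, smul_eq_mul] at key hM
  rw [le_div_iff₀ hε'] at key
  set a := (μ' Set.univ).toReal
  set b := (ν' Set.univ).toReal
  have ha : a⁻¹ * (1 - ε) ≤ 1 := by
    rw [inv_mul_le_iff₀ (by linarith)]; linarith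
  have hb : b⁻¹ * (1 - ε) ≤ 1 := by
    rw [inv_mul_le_iff₀ (by linarith)]; linarith
  have k1 := mul_le_mul_of_nonneg_right ha nF
  have k2 := mul_le_mul_of_nonneg_right hb nG
  have k3 : ∫ x, F x ∂(μ - μ') + ∫ x, G x ∂(ν - ν') ≤ 0 := by
    linarith
  constructor
  · intro x hx z
    have := supp_aux (μ - μ') F hF0 (by linarith) x hx
    have h2 : S - f x = 0 := this
    linarith [hfS z]
  · intro x hx z
    have := supp_aux (ν - ν') G hG0 (by linarith) x hx
    have h2 : -I - fc x = 0 := this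
    linarith [hfI z, hfc x]

end
end

section
/- (Dependence on ε.) Let (X,d) be a compact metric space, p ∈ [1,∞], 0 ≤ ε ≤ ε' ≤ 1, and μ, ν probability measures on X. Then: (i) W_p^{‖μ−ν‖_TV/2}(μ,ν) = 0 and W_p^0(μ,ν) = W_p(μ,ν); (ii) W_p^{ε'}(μ,ν) ≤ W_p^{ε}(μ,ν); (iii) W_p^{ε}(μ,ν) ≤ ((1−ε')/(1−ε))^{1/p}·W_p^{ε'}(μ,ν) + 4·diam(X)·((ε'−ε)/(1−ε))^{1/p}. -/
open MeasureTheory ENNReal Filter Topology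

noncomputable section

variable {X : Type*} [MetricSpace X] [MeasurableSpace X] [BorelSpace X]

lemma aux_dist_le [CompactSpace X] (p : ℝ≥0∞) (π : Measure (X × X)) [IsProbabilityMeasure π] :
    eLpNorm (fun z : X × X => dist z.1 z.2) p π
      ≤ ENNReal.ofReal (Metric.diam (Set.univ : Set X)) := by
  have h := eLpNorm_le_of_ae_bound (μ := π) (p := p) (f := fun z : X × X => dist z.1 z.2)
    (C := Metric.diam (Set.univ : Set X)) (Eventually.of_forall fun z => by
      rw [Real.norm_of_nonneg dist_nonneg]
      exact Metric.dist_le_diam_of_mem isCompact_univ.isBounded trivial trivial)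
  simpa using h

lemma aux_Wp_le [CompactSpace X] (p : ℝ≥0∞) (μ ν : Measure X) [IsProbabilityMeasure μ]
    [IsProbabilityMeasure ν] :
    Wp p μ ν ≤ ENNReal.ofReal (Metric.diam (Set.univ : Set X)) := by
  refine (iInf₂_le (μ.prod ν) ?_).trans (aux_dist_le p _)
  constructor <;> simp

lemma aux_Wp_self [CompactSpace X] (p : ℝ≥0∞) (μ : Measure X) : Wp p μ μ = 0 := by
  have hm : Measurable (fun x : X => (x, x)) := by fun_prop
  have hc : μ.map (fun x : X => (x, x)) ∈ couplings μ μ := by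
    constructor
    · rw [Measure.map_map measurable_fst hm]
      exact Measure.map_id
    · rw [Measure.map_map measurable_snd hm]
      exact Measure.map_id
  refine le_antisymm ((iInf₂_le _ hc).trans (le_of_eq ?_)) zero_le
  have hd : Measurable (fun z : X × X => dist z.1 z.2) := continuous_dist.measurable
  rw [eLpNorm_map_measure hd.aestronglyMeasurable hm.aemeasurable]
  have : (fun z : X × X => dist z.1 z.2) ∘ (fun x : X => (x, x)) = fun _ => 0 := by
    ext x; simp
  rw [this]
  simp

lemma aux_mass (μ μ' : Measure X) [IsProbabilityMeasure μ] (h : μ' ≤ μ) :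
    (μ - μ') Set.univ = 1 - μ' Set.univ := by
  have : IsFiniteMeasure μ' := isFiniteMeasure_of_le μ h
  rw [Measure.sub_apply MeasurableSet.univ h, measure_univ]

lemma aux_RWp_le (p : ℝ≥0∞) (ε : ℝ) (μ ν μ' ν' : Measure X) (h1 : μ' ≤ μ) (h2 : ν' ≤ ν)
    (h3 : (μ - μ') Set.univ ≤ ENNReal.ofReal ε) (h4 : (ν - ν') Set.univ ≤ ENNReal.ofReal ε) :
    RWp p ε μ ν ≤ Wp p ((μ' Set.univ)⁻¹ • μ') ((ν' Set.univ)⁻¹ • ν') :=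
  iInf_le_of_le μ' <| iInf_le_of_le ν' <| iInf_le_of_le h1 <| iInf_le_of_le h2 <|
    iInf_le_of_le h3 <| iInf_le_of_le h4 le_rfl

lemma aux_le_RWp (p : ℝ≥0∞) (ε : ℝ) (μ ν : Measure X) (L : ℝ≥0∞)
    (h : ∀ μ' ν' : Measure X, μ' ≤ μ → ν' ≤ ν → (μ - μ') Set.univ ≤ ENNReal.ofReal ε →
      (ν - ν') Set.univ ≤ ENNReal.ofReal ε →
      L ≤ Wp p ((μ' Set.univ)⁻¹ • μ') ((ν' Set.univ)⁻¹ • ν')) :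
    L ≤ RWp p ε μ ν :=
  le_iInf fun μ' => le_iInf fun ν' => le_iInf fun h1 => le_iInf fun h2 => le_iInf fun h3 =>
    le_iInf fun h4 => h μ' ν' h1 h2 h3 h4

lemma aux_mono (p : ℝ≥0∞) (ε ε' : ℝ) (h : ε ≤ ε') (μ ν : Measure X) :
    RWp p ε' μ ν ≤ RWp p ε μ ν :=
  aux_le_RWp _ _ _ _ _ fun μ' ν' h1 h2 h3 h4 =>
    aux_RWp_le _ _ _ _ _ _ h1 h2 (h3.trans (ENNReal.ofReal_le_ofReal h))
      (h4.trans (ENNReal.ofReal_le_ofReal h))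

lemma aux_zero (p : ℝ≥0∞) (μ ν : Measure X) [IsProbabilityMeasure μ]
    [IsProbabilityMeasure ν] : RWp p 0 μ ν = Wp p μ ν := by
  apply le_antisymm
  · have := aux_RWp_le p 0 μ ν μ ν le_rfl le_rfl (by simp) (by simp)
    simpa using this
  · refine aux_le_RWp _ _ _ _ _ fun μ' ν' h1 h2 h3 h4 => ?_
    have key : ∀ (m m' : Measure X) [IsProbabilityMeasure m], m' ≤ m →
        (m - m') Set.univ ≤ ENNReal.ofReal 0 → m' = m := by
      intro m m' _ h h'
      have : IsFiniteMeasure m' := isFiniteMeasure_of_le m h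
      have h0 : m - m' = 0 := by
        rw [← Measure.measure_univ_eq_zero]; simpa using h'
      have := Measure.sub_add_cancel_of_le h
      rw [h0, zero_add] at this
      exact this
    rw [key μ μ' h1 h3, key ν ν' h2 h4]
    simp

lemma aux_tv [CompactSpace X] (p : ℝ≥0∞) (μ ν : Measure X) [IsProbabilityMeasure μ]
    [IsProbabilityMeasure ν] : RWp p
      (((μ.toSignedMeasure - ν.toSignedMeasure).totalVariation Set.univ).toReal / 2) μ ν
        = 0 := by
  have hadd : μ + (ν - μ) = ν + (μ - ν) := by
    have h := Measure.sub_toSignedMeasure_eq_toSignedMeasure_sub (μ := μ) (ν := ν)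
    rw [sub_eq_sub_iff_add_eq_add, ← Measure.toSignedMeasure_add,
      ← Measure.toSignedMeasure_add, Measure.toSignedMeasure_eq_toSignedMeasure_iff] at h
    first | exact h | (rw [h, add_comm]) | (rw [← h, add_comm])
  have hu : (ν - μ) Set.univ = (μ - ν) Set.univ := by
    have := congrArg (fun m : Measure X => m Set.univ) hadd
    simp only [Measure.add_apply, measure_univ] at this
    exact (ENNReal.add_right_inj one_ne_top).1 this
  have htv : ENNReal.ofReal
      (((μ.toSignedMeasure - ν.toSignedMeasure).totalVariation Set.univ).toReal / 2)
      = (μ - ν) Set.univ := by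
    rw [SignedMeasure.totalVariation, Measure.toJordanDecomposition_toSignedMeasure_sub]
    simp only [Measure.jordanDecompositionOfToSignedMeasureSub, Measure.add_apply, hu]
    rw [ENNReal.toReal_add (measure_ne_top _ _) (measure_ne_top _ _), add_self_div_two,
      ENNReal.ofReal_toReal (measure_ne_top _ _)]
  have hle : μ - ν ≤ μ := Measure.sub_le
  set m := μ - (μ - ν) with hm
  have h1 : m ≤ μ := Measure.sub_le
  have h2 : m ≤ ν := Measure.sub_le_of_le_add (hadd ▸ Measure.le_add_right le_rfl)
  have hmu : (μ - m) Set.univ = (μ - ν) Set.univ := by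
    rw [aux_mass μ m h1, hm, Measure.sub_apply MeasurableSet.univ hle, measure_univ]
    exact ENNReal.sub_sub_cancel one_ne_top ((hle Set.univ).trans_eq measure_univ)
  have hnu : (ν - m) Set.univ = (μ - ν) Set.univ := by
    rw [← hmu, aux_mass μ m h1, aux_mass ν m h2]
  have := aux_RWp_le p _ μ ν m m h1 h2 (hmu.trans htv.symm).le (hnu.trans htv.symm).le
  rw [aux_Wp_self] at this
  exact le_antisymm this zero_le

lemma aux_ext (ε ε' : ℝ) (hε0 : 0 ≤ ε) (h : ε < ε') (h' : ε' < 1) (μ μ' : Measure X)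
    [IsProbabilityMeasure μ] (hle : μ' ≤ μ) (hmass : (μ - μ') Set.univ ≤ ENNReal.ofReal ε') :
    ∃ μ₁ α : Measure X, μ₁ ≤ μ ∧ (μ - μ₁) Set.univ ≤ ENNReal.ofReal ε ∧ IsProbabilityMeasure α ∧
      IsProbabilityMeasure ((μ' Set.univ)⁻¹ • μ') ∧
      (μ₁ Set.univ)⁻¹ • μ₁ = ENNReal.ofReal ((1 - ε') / (1 - ε)) • ((μ' Set.univ)⁻¹ • μ') +
        ENNReal.ofReal ((ε' - ε) / (1 - ε)) • α := by
  have hfin : IsFiniteMeasure μ' := isFiniteMeasure_of_le μ hle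
  rw [aux_mass μ μ' hle] at hmass
  obtain ⟨m, hm0, hm⟩ : ∃ m : ℝ, 0 ≤ m ∧ μ' Set.univ = ENNReal.ofReal m :=
    ⟨_, ENNReal.toReal_nonneg, (ENNReal.ofReal_toReal (measure_ne_top _ _)).symm⟩
  have hm1 : 1 - ε' ≤ m := by
    rw [hm, ← ENNReal.ofReal_one, ← ENNReal.ofReal_sub _ hm0,
      ENNReal.ofReal_le_ofReal_iff (by linarith)] at hmass
    linarith
  have hmpos : 0 < m := by linarith
  have e1 : 0 < 1 - ε := by linarith
  have e2 : 0 < ε' := by linarith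
  have e3 : 0 < 1 - ε' := by linarith
  set μ₂ : Measure X := ENNReal.ofReal ((1 - ε') / m) • μ' with hμ₂
  have hμ₂u : μ₂ Set.univ = ENNReal.ofReal (1 - ε') := by
    rw [hμ₂, Measure.smul_apply, hm, smul_eq_mul, ← ENNReal.ofReal_mul (by positivity)]
    congr 1; field_simp
  have hμ₂le : μ₂ ≤ μ := by
    refine le_trans ?_ hle
    intro s
    rw [hμ₂, Measure.smul_apply, smul_eq_mul]
    refine mul_le_of_le_one_left zero_le ?_
    rw [ENNReal.ofReal_le_one, div_le_one hmpos]; exact hm1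
  have hfin2 : IsFiniteMeasure μ₂ := isFiniteMeasure_of_le μ hμ₂le
  set σ := μ - μ₂ with hσ
  have hσu : σ Set.univ = ENNReal.ofReal ε' := by
    rw [hσ, aux_mass μ μ₂ hμ₂le, hμ₂u, ← ENNReal.ofReal_one, ← ENNReal.ofReal_sub _ e3.le]
    congr 1; ring
  have hσadd : σ + μ₂ = μ := Measure.sub_add_cancel_of_le hμ₂le
  have hc : ENNReal.ofReal ((ε' - ε) / ε') ≤ 1 := by
    rw [ENNReal.ofReal_le_one, div_le_one e2]; linarith
  have hb : 0 ≤ ε' - ε := by linarith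
  have hu : (ENNReal.ofReal ((ε' - ε) / ε') • σ + μ₂) Set.univ = ENNReal.ofReal (1 - ε) := by
    rw [Measure.add_apply, Measure.smul_apply, hσu, hμ₂u, smul_eq_mul,
      ← ENNReal.ofReal_mul (by positivity), ← ENNReal.ofReal_add (by positivity) e3.le]
    congr 1; field_simp; ring
  have hle1 : ENNReal.ofReal ((ε' - ε) / ε') • σ + μ₂ ≤ μ := by
    conv_rhs => rw [← hσadd]
    refine add_le_add_left ?_ _
    intro s
    rw [Measure.smul_apply, smul_eq_mul]
    exact mul_le_of_le_one_left zero_le hc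
  refine ⟨ENNReal.ofReal ((ε' - ε) / ε') • σ + μ₂, ENNReal.ofReal (1 / ε') • σ, hle1, ?_, ⟨?_⟩,
    ⟨?_⟩, ?_⟩
  · rw [aux_mass _ _ hle1, hu, ← ENNReal.ofReal_one, ← ENNReal.ofReal_sub _ e1.le]
    exact ENNReal.ofReal_le_ofReal (by linarith)
  · rw [Measure.smul_apply, hσu, smul_eq_mul, ← ENNReal.ofReal_mul (by positivity),
      ← ENNReal.ofReal_one]
    congr 1; field_simp
  · rw [Measure.smul_apply, smul_eq_mul]
    exact ENNReal.inv_mul_cancel (by rw [hm]; simpa using hmpos) (measure_ne_top _ _)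
  · rw [hu, hm, hμ₂, smul_add, smul_smul, smul_smul, smul_smul, smul_smul, add_comm,
      ← ENNReal.ofReal_inv_of_pos e1, ← ENNReal.ofReal_inv_of_pos hmpos,
      ← ENNReal.ofReal_mul (by positivity), ← ENNReal.ofReal_mul (by positivity),
      ← ENNReal.ofReal_mul (by positivity), ← ENNReal.ofReal_mul (by positivity)]
    congr 3 <;> field_simp

lemma aux_norm_add {Y : Type*} [MeasurableSpace Y] (p : ℝ≥0∞) (hp : 1 ≤ p) (hpt : p ≠ ∞)
    (f : Y → ℝ) (a b : ℝ≥0∞) (π ρ : Measure Y) :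
    eLpNorm f p (a • π + b • ρ) ≤
      a ^ (1 / p.toReal) * eLpNorm f p π + b ^ (1 / p.toReal) * eLpNorm f p ρ := by
  have hp0 : p ≠ 0 := (zero_lt_one.trans_le hp).ne'
  have hp1 : 1 ≤ p.toReal := by
    simpa using ENNReal.toReal_mono hpt hp
  have hs : ∀ (c : ℝ≥0∞) (τ : Measure Y),
      c ^ (1 / p.toReal) * eLpNorm f p τ = eLpNorm f p (c • τ) := by
    intro c τ
    rw [eLpNorm_smul_measure_of_ne_top hpt]
    simp
  rw [hs, hs]
  simp only [eLpNorm_eq_lintegral_rpow_enorm_toReal hp0 hpt, lintegral_add_measure]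
  exact ENNReal.rpow_add_le_add_rpow _ _ (by positivity)
    (by rw [div_le_one (by positivity)]; exact hp1)

/-- dependence on the robustness radius: for `p ∈ [1,∞]`,
`0 ≤ ε ≤ ε' ≤ 1`, and probability measures `μ, ν` on a compact metric space:
(i) `W_p^{‖μ−ν‖_TV/2}(μ,ν) = 0` and `W_p^0(μ,ν) = W_p(μ,ν)`;
(ii) `W_p^{ε'}(μ,ν) ≤ W_p^{ε}(μ,ν)`;
(iii) `W_p^{ε}(μ,ν) ≤ ((1−ε')/(1−ε))^{1/p}·W_p^{ε'}(μ,ν)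
        + 4·diam(X)·((ε'−ε)/(1−ε))^{1/p}`. -/
theorem RWp_eps_dependence {X : Type*} [MetricSpace X] [CompactSpace X]
    [MeasurableSpace X] [BorelSpace X]
    (p : ℝ≥0∞) (hp : 1 ≤ p) (ε ε' : ℝ) (hε0 : 0 ≤ ε) (hεε' : ε ≤ ε') (hε'1 : ε' ≤ 1)
    (μ ν : Measure X) [IsProbabilityMeasure μ] [IsProbabilityMeasure ν] :
    RWp p
      (((μ.toSignedMeasure - ν.toSignedMeasure).totalVariation Set.univ).toReal / 2) μ ν
        = 0 ∧
    RWp p 0 μ ν = Wp p μ ν ∧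
    RWp p ε' μ ν ≤ RWp p ε μ ν ∧
    RWp p ε μ ν ≤
      ENNReal.ofReal (((1 - ε') / (1 - ε)) ^ (1 / p.toReal)) * RWp p ε' μ ν +
        ENNReal.ofReal
          (4 * Metric.diam (Set.univ : Set X) * ((ε' - ε) / (1 - ε)) ^ (1 / p.toReal)) := by
  refine ⟨aux_tv p μ ν, aux_zero p μ ν, aux_mono p ε ε' hεε' μ ν, ?_⟩
  have hdiam : 0 ≤ Metric.diam (Set.univ : Set X) := Metric.diam_nonneg
  have hbd : RWp p ε μ ν ≤ ENNReal.ofReal (Metric.diam (Set.univ : Set X)) :=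
    (aux_mono p 0 ε hε0 μ ν).trans ((aux_zero p μ ν).le.trans (aux_Wp_le p μ ν))
  have htriv : ((ε' - ε) / (1 - ε)) ^ (1 / p.toReal) = 1 → RWp p ε μ ν ≤
      ENNReal.ofReal (((1 - ε') / (1 - ε)) ^ (1 / p.toReal)) * RWp p ε' μ ν +
        ENNReal.ofReal
          (4 * Metric.diam (Set.univ : Set X) * ((ε' - ε) / (1 - ε)) ^ (1 / p.toReal)) := by
    intro h
    rw [h]
    exact hbd.trans ((ENNReal.ofReal_le_ofReal (by linarith)).trans le_add_self)
  rcases eq_or_ne p ∞ with hpt | hpt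
  · exact htriv (by simp [hpt])
  rcases hεε'.eq_or_lt with rfl | hlt
  · rcases hε'1.eq_or_lt with rfl | h1
    · have h0 : RWp p 1 μ ν ≤ Wp p (0 : Measure X) 0 := by
        have := aux_RWp_le p 1 μ ν 0 0 (Measure.zero_le _) (Measure.zero_le _)
          (by simp) (by simp)
        simpa using this
      rw [aux_Wp_self] at h0
      exact h0.trans zero_le
    · rw [div_self (by linarith), Real.one_rpow, ENNReal.ofReal_one, one_mul]
      exact le_self_add
  rcases hε'1.eq_or_lt with rfl | h1
  · exact htriv (by rw [div_self (by linarith), Real.one_rpow])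
  have e1 : 0 < 1 - ε := by linarith
  have e3 : 0 < 1 - ε' := by linarith
  have hb : 0 ≤ (ε' - ε) / (1 - ε) := div_nonneg (by linarith) e1.le
  have ha : 0 < (1 - ε') / (1 - ε) := by positivity
  have hA : 0 < ((1 - ε') / (1 - ε)) ^ (1 / p.toReal) := Real.rpow_pos_of_pos ha _
  rw [← tsub_le_iff_right, ← ENNReal.div_le_iff' (by simpa using hA) ENNReal.ofReal_ne_top]
  refine aux_le_RWp _ _ _ _ _ fun μ' ν' h1' h2' h3' h4' => ?_
  obtain ⟨μ₁, α, hμ1, hμ2, hα, hμp, hμe⟩ := aux_ext ε ε' hε0 hlt h1 μ μ' h1' h3'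
  obtain ⟨ν₁, β, hν1, hν2, hβ, hνp, hνe⟩ := aux_ext ε ε' hε0 hlt h1 ν ν' h2' h4'
  refine le_iInf₂ fun π hπ => ?_
  rw [ENNReal.div_le_iff' (by simpa using hA) ENNReal.ofReal_ne_top, tsub_le_iff_right]
  refine (aux_RWp_le p ε μ ν μ₁ ν₁ hμ1 hν1 hμ2 hν2).trans ?_
  rw [hμe, hνe]
  refine (iInf₂_le (ENNReal.ofReal ((1 - ε') / (1 - ε)) • π +
    ENNReal.ofReal ((ε' - ε) / (1 - ε)) • α.prod β) ?_).trans ?_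
  · constructor
    · rw [Measure.map_add _ _ measurable_fst, Measure.map_smul, Measure.map_smul, hπ.1]
      simp
    · rw [Measure.map_add _ _ measurable_snd, Measure.map_smul, Measure.map_smul, hπ.2]
      simp
  · refine (aux_norm_add p hp hpt _ _ _ _ _).trans ?_
    have hq : 0 ≤ 1 / p.toReal := by positivity
    rw [ENNReal.ofReal_rpow_of_nonneg ha.le hq, ENNReal.ofReal_rpow_of_nonneg hb hq]
    refine add_le_add_right ?_ _
    refine (mul_le_mul_right (aux_dist_le p (α.prod β)) _).trans ?_
    have hB := Real.rpow_nonneg hb (1 / p.toReal)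
    rw [← ENNReal.ofReal_mul hB]
    refine ENNReal.ofReal_le_ofReal ?_
    nlinarith [mul_nonneg hB hdiam]

end
end

section
/- (Alternative primal form.) Let (X,d) be a compact metric space, p ∈ [1,∞], ε ∈ [0,1), and μ, ν probability measures on X. Then W_p^ε(μ,ν) = inf{ ‖d‖_{L^p(π)} : π ∈ P(X × X), μ ∈ B_ε(π₁), ν ∈ B_ε(π₂) }, where π₁ and π₂ denote the first and second marginals of π. -/
open MeasureTheory ENNReal Filter Topology

noncomputable section

variable {X : Type*} [MetricSpace X] [MeasurableSpace X] [BorelSpace X]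

lemma huber_aux {X : Type*} [MeasurableSpace X]
    (ε : ℝ) (hε0 : 0 ≤ ε) (hε1 : ε < 1)
    (μ μ' : Measure X) [IsProbabilityMeasure μ] (h : μ' ≤ μ)
    (h2 : (μ - μ') Set.univ ≤ ENNReal.ofReal ε) :
    IsProbabilityMeasure ((μ' Set.univ)⁻¹ • μ') ∧
    ∃ α : Measure X, IsProbabilityMeasure α ∧
      μ = ENNReal.ofReal (1 - ε) • ((μ' Set.univ)⁻¹ • μ') + ENNReal.ofReal ε • α := by
  have : IsFiniteMeasure μ' := isFiniteMeasure_of_le μ h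
  rw [Measure.sub_apply MeasurableSet.univ h, measure_univ] at h2
  have hone : ENNReal.ofReal (1 - ε) + ENNReal.ofReal ε = 1 := by
    rw [← ENNReal.ofReal_add (by linarith) hε0]; simp
  have hm : ENNReal.ofReal (1 - ε) ≤ μ' Set.univ := by
    have := tsub_le_iff_right.1 h2
    rw [← hone, add_comm] at this
    exact (ENNReal.add_le_add_iff_left ENNReal.ofReal_ne_top).1 this
  have hpos : 0 < ENNReal.ofReal (1 - ε) := ENNReal.ofReal_pos.2 (by linarith)
  have hm0 : μ' Set.univ ≠ 0 := (hpos.trans_le hm).ne'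
  have hmt : μ' Set.univ ≠ ⊤ := measure_ne_top _ _
  have hP : IsProbabilityMeasure ((μ' Set.univ)⁻¹ • μ') :=
    ⟨by simp [ENNReal.inv_mul_cancel hm0 hmt]⟩
  refine ⟨hP, ?_⟩
  set ρ := (μ' Set.univ)⁻¹ • μ' with hρ
  have hle : ENNReal.ofReal (1 - ε) • ρ ≤ μ := by
    refine le_trans ?_ h
    rw [Measure.le_iff]
    intro s _
    simp only [hρ, Measure.smul_apply, smul_eq_mul]
    rw [← mul_assoc]
    calc _ ≤ 1 * μ' s := by
          gcongr
          rw [← ENNReal.mul_inv_cancel hm0 hmt]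
          gcongr
      _ = _ := one_mul _
  have : IsFiniteMeasure (ENNReal.ofReal (1 - ε) • ρ) := isFiniteMeasure_of_le μ hle
  have hsub : (μ - ENNReal.ofReal (1 - ε) • ρ) Set.univ = ENNReal.ofReal ε := by
    rw [Measure.sub_apply MeasurableSet.univ hle]
    simp only [measure_univ, Measure.smul_apply, smul_eq_mul, mul_one]
    rw [← hone, ENNReal.add_sub_cancel_left ENNReal.ofReal_ne_top]
  have hadd := Measure.sub_add_cancel_of_le hle
  rcases hε0.eq_or_lt with h0 | h0
  · refine ⟨μ, inferInstance, ?_⟩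
    subst h0
    simp only [ENNReal.ofReal_zero, Measure.measure_univ_eq_zero] at hsub
    rw [hsub] at hadd
    simpa using hadd.symm
  · have he0 : ENNReal.ofReal ε ≠ 0 := (ENNReal.ofReal_pos.2 h0).ne'
    refine ⟨(ENNReal.ofReal ε)⁻¹ • (μ - ENNReal.ofReal (1 - ε) • ρ), ⟨?_⟩, ?_⟩
    · rw [Measure.smul_apply, hsub, smul_eq_mul,
        ENNReal.inv_mul_cancel he0 ENNReal.ofReal_ne_top]
    · clear_value ρ
      rw [smul_smul, ENNReal.mul_inv_cancel he0 ENNReal.ofReal_ne_top, one_smul, add_comm]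
      exact hadd.symm

lemma huber_aux2 {X : Type*} [MeasurableSpace X]
    (ε : ℝ) (hε0 : 0 ≤ ε) (hε1 : ε < 1)
    (μ ρ : Measure X) [IsProbabilityMeasure μ] [IsProbabilityMeasure ρ]
    (h : ∃ α : Measure X, IsProbabilityMeasure α ∧
      μ = ENNReal.ofReal (1 - ε) • ρ + ENNReal.ofReal ε • α) :
    ENNReal.ofReal (1 - ε) • ρ ≤ μ ∧
    (μ - ENNReal.ofReal (1 - ε) • ρ) Set.univ ≤ ENNReal.ofReal ε ∧
    ((ENNReal.ofReal (1 - ε) • ρ) Set.univ)⁻¹ • (ENNReal.ofReal (1 - ε) • ρ) = ρ := by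
  obtain ⟨α, hα, h⟩ := h
  have hle : ENNReal.ofReal (1 - ε) • ρ ≤ μ := by rw [h]; exact Measure.le_add_right le_rfl
  have : IsFiniteMeasure (ENNReal.ofReal (1 - ε) • ρ) := isFiniteMeasure_of_le μ hle
  have hone : ENNReal.ofReal (1 - ε) + ENNReal.ofReal ε = 1 := by
    rw [← ENNReal.ofReal_add (by linarith) hε0]; simp
  have hpos : 0 < ENNReal.ofReal (1 - ε) := ENNReal.ofReal_pos.2 (by linarith)
  refine ⟨hle, ?_, ?_⟩
  · rw [Measure.sub_apply MeasurableSet.univ hle]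
    simp only [measure_univ, Measure.smul_apply, smul_eq_mul, mul_one]
    rw [← hone, ENNReal.add_sub_cancel_left ENNReal.ofReal_ne_top]
  · simp only [measure_univ, Measure.smul_apply, smul_eq_mul, mul_one]
    rw [smul_smul, ENNReal.inv_mul_cancel hpos.ne' ENNReal.ofReal_ne_top, one_smul]

/-- alternative primal form: on a compact metric space, for `p ∈ [1,∞]`
and `ε ∈ [0,1)`,
`W_p^ε(μ,ν) = inf {‖d‖_{L^p(π)} : π ∈ P(X×X), μ ∈ B_ε(π₁), ν ∈ B_ε(π₂)}`. -/
theorem RWp_coupling_primal {X : Type*} [MetricSpace X] [CompactSpace X]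
    [MeasurableSpace X] [BorelSpace X]
    (p : ℝ≥0∞) (hp : 1 ≤ p) (ε : ℝ) (hε0 : 0 ≤ ε) (hε1 : ε < 1)
    (μ ν : Measure X) [IsProbabilityMeasure μ] [IsProbabilityMeasure ν] :
    RWp p ε μ ν =
      ⨅ (π : Measure (X × X)) (_ : IsProbabilityMeasure π)
        (_ : μ ∈ huberBall ε (π.map Prod.fst)) (_ : ν ∈ huberBall ε (π.map Prod.snd)),
        eLpNorm (fun z : X × X => dist z.1 z.2) p π := by
  apply le_antisymm
  · refine le_iInf fun π => le_iInf fun hπ => le_iInf fun h1 => le_iInf fun h2 => ?_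
    have : IsProbabilityMeasure (π.map Prod.fst) :=
      Measure.isProbabilityMeasure_map measurable_fst.aemeasurable
    have : IsProbabilityMeasure (π.map Prod.snd) :=
      Measure.isProbabilityMeasure_map measurable_snd.aemeasurable
    obtain ⟨a1, b1, c1⟩ := huber_aux2 ε hε0 hε1 μ _ h1
    obtain ⟨a2, b2, c2⟩ := huber_aux2 ε hε0 hε1 ν _ h2
    unfold RWp
    refine iInf_le_of_le (ENNReal.ofReal (1 - ε) • π.map Prod.fst) ?_
    refine iInf_le_of_le (ENNReal.ofReal (1 - ε) • π.map Prod.snd) ?_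
    refine iInf_le_of_le a1 ?_
    refine iInf_le_of_le a2 ?_
    refine iInf_le_of_le b1 ?_
    refine iInf_le_of_le b2 ?_
    rw [c1, c2]
    exact iInf_le_of_le π <| iInf_le_of_le ⟨rfl, rfl⟩ le_rfl
  · refine le_iInf fun μ' => le_iInf fun ν' => le_iInf fun a1 => le_iInf fun a2 =>
      le_iInf fun b1 => le_iInf fun b2 => le_iInf fun π => le_iInf fun hπ => ?_
    obtain ⟨p1, q1⟩ := huber_aux ε hε0 hε1 μ μ' a1 b1
    obtain ⟨p2, q2⟩ := huber_aux ε hε0 hε1 ν ν' a2 b2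
    obtain ⟨e1, e2⟩ := hπ
    rw [← e1] at q1 p1
    rw [← e2] at q2
    have hP : IsProbabilityMeasure π := ⟨by
      have := p1.measure_univ
      rwa [Measure.map_apply measurable_fst MeasurableSet.univ, Set.preimage_univ] at this⟩
    exact iInf_le_of_le π <| iInf_le_of_le hP <| iInf_le_of_le q1 <| iInf_le_of_le q2 le_rfl

end
end

section
/- (Convergence of couplings.) Let (X,d) be a compact metric space, p ∈ [1,∞], and μ, ν probability measures on X. Suppose ε_n ↘ 0 and, for each n, π_n ∈ P(X × X) attains the infimum in the alternative primal form of W_p^{ε_n}(μ,ν), i.e., π_n minimizes ‖d‖_{L^p(π)} over π with μ ∈ B_{ε_n}(π₁) and ν ∈ B_{ε_n}(π₂). Then {π_n} admits a subsequence converging weakly to an optimal coupling for W_p(μ,ν). -/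
open MeasureTheory ENNReal Filter Topology

noncomputable section

variable {X : Type*} [MetricSpace X] [MeasurableSpace X] [BorelSpace X]

/-- The alternative (near-coupling) primal value of `W_p^ε(μ,ν)`. -/
def altPrimal (p : ℝ≥0∞) (ε : ℝ) (μ ν : Measure X) : ℝ≥0∞ :=
  ⨅ (π : Measure (X × X)) (_ : IsProbabilityMeasure π)
    (_ : μ ∈ huberBall ε (π.map Prod.fst)) (_ : ν ∈ huberBall ε (π.map Prod.snd)),
    eLpNorm (fun z : X × X => dist z.1 z.2) p π

theorem onc_marginal {Y Z : Type*} [MetricSpace Y] [MeasurableSpace Y] [BorelSpace Y]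
    [TopologicalSpace Z] [MeasurableSpace Z] [BorelSpace Z]
    (μ : Measure Y) [IsProbabilityMeasure μ] (g : Z → Y) (hg : Continuous g)
    (ε : ℕ → ℝ) (hpos : ∀ n, 0 ≤ ε n) (hlim : Tendsto ε atTop (𝓝 0))
    (P : ℕ → Measure Z) (hP : ∀ n, IsProbabilityMeasure (P n))
    (Q : Measure Z) [IsProbabilityMeasure Q]
    (hfeas : ∀ n, μ ∈ huberBall (ε n) ((P n).map g))
    (hconv : ∀ f : BoundedContinuousFunction Z ℝ,
      Tendsto (fun k => ∫ z, f z ∂(P k)) atTop (𝓝 (∫ z, f z ∂Q))) :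
    Q.map g = μ := by
  have : IsProbabilityMeasure (Q.map g) := Measure.isProbabilityMeasure_map hg.measurable.aemeasurable
  apply ext_of_forall_integral_eq_of_IsFiniteMeasure
  intro f
  have hf (m : Measure Z) : ∫ x, f x ∂(m.map g) = ∫ z, f (g z) ∂m :=
    integral_map hg.measurable.aemeasurable f.continuous.measurable.aestronglyMeasurable
  rw [hf]
  have h1 := hconv (f.compContinuous ⟨g, hg⟩)
  simp only [BoundedContinuousFunction.compContinuous_apply, ContinuousMap.coe_mk] at h1
  choose α hα hμ using hfeas
  have hsmall : ∀ᶠ n in atTop, ε n ≤ 1 := (hlim.eventually (gt_mem_nhds zero_lt_one)).mono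
    fun _ h => le_of_lt h
  have heq : ∀ᶠ n in atTop, ∫ x, f x ∂μ =
      (1 - ε n) * ∫ z, f (g z) ∂(P n) + ε n * ∫ x, f x ∂(α n) := by
    filter_upwards [hsmall] with n hn
    have := hα n
    have := hP n
    have : IsProbabilityMeasure ((P n).map g) :=
      Measure.isProbabilityMeasure_map hg.measurable.aemeasurable
    conv_lhs => rw [hμ n]
    rw [integral_add_measure ((f.integrable _).smul_measure ofReal_ne_top)
      ((f.integrable _).smul_measure ofReal_ne_top), integral_smul_measure,
      integral_smul_measure, hf, toReal_ofReal (by linarith), toReal_ofReal (hpos n)]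
    simp
  have h2 : Tendsto (fun n => ε n * ∫ x, f x ∂(α n)) atTop (𝓝 0) := by
    have hb : Tendsto (fun n => ε n * ‖f‖) atTop (𝓝 0) := by simpa using hlim.mul_const ‖f‖
    refine squeeze_zero_norm (fun n => ?_) hb
    have := hα n
    rw [norm_mul, Real.norm_of_nonneg (hpos n)]
    exact mul_le_mul_of_nonneg_left (f.norm_integral_le_norm _) (hpos n)
  have h3 : Tendsto (fun n => (1 - ε n) * ∫ z, f (g z) ∂(P n) + ε n * ∫ x, f x ∂(α n)) atTop
      (𝓝 (∫ z, f (g z) ∂Q)) := by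
    simpa using ((tendsto_const_nhds (x := (1:ℝ))).sub hlim |>.mul h1).add h2
  exact tendsto_nhds_unique h3 (tendsto_const_nhds.congr' heq)

theorem onc_lsc {Y : Type*} [MetricSpace Y] [CompactSpace Y] [MeasurableSpace Y] [BorelSpace Y]
    (p : ℝ≥0∞) (hp : 1 ≤ p) (P : ℕ → ProbabilityMeasure (Y × Y)) (Q : ProbabilityMeasure (Y × Y))
    (hconv : Tendsto P atTop (𝓝 Q)) (W : ℝ≥0∞)
    (hW : ∀ᶠ n in atTop,
      eLpNorm (fun z : Y × Y => dist z.1 z.2) p (P n : Measure (Y × Y)) ≤ W) :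
    eLpNorm (fun z : Y × Y => dist z.1 z.2) p (Q : Measure (Y × Y)) ≤ W := by
  have hen (z : Y × Y) : ‖dist z.1 z.2‖ₑ = (nndist z.1 z.2 : ℝ≥0∞) := by
    rw [← edist_nndist, edist_dist, Real.enorm_of_nonneg dist_nonneg]
  by_cases hpt : p = ∞
  · subst hpt
    simp only [eLpNorm_exponent_top] at hW ⊢
    have hopen : IsOpen {z : Y × Y | W < ‖dist z.1 z.2‖ₑ} := by
      apply isOpen_lt <;> fun_prop
    have hz : (Q : Measure (Y × Y)) {z : Y × Y | W < ‖dist z.1 z.2‖ₑ} = 0 := by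
      have h := ProbabilityMeasure.le_liminf_measure_open_of_tendsto hconv hopen
      have h0 : (fun n => (P n : Measure (Y × Y)) {z : Y × Y | W < ‖dist z.1 z.2‖ₑ})
          =ᶠ[atTop] fun _ => 0 := by
        filter_upwards [hW] with n hn
        have hae := ae_le_eLpNormEssSup (f := fun z : Y × Y => dist z.1 z.2)
          (μ := (P n : Measure (Y × Y)))
        refine measure_mono_null (fun z hz => ?_) (ae_iff.1 hae)
        exact not_le.2 (lt_of_le_of_lt hn hz)
      rw [liminf_congr h0] at h
      simpa using h
    refine essSup_le_of_ae_le W ?_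
    change ∀ᵐ z ∂(Q : Measure (Y × Y)), ‖dist z.1 z.2‖ₑ ≤ W
    rw [ae_iff]
    simpa only [not_le] using hz
  · have hp0 : p ≠ 0 := (zero_lt_one.trans_le hp).ne'
    have hpr : 0 < p.toReal := toReal_pos hp0 hpt
    simp only [eLpNorm_eq_lintegral_rpow_enorm_toReal hp0 hpt, one_div,
      ENNReal.rpow_inv_le_iff hpr] at hW ⊢
    let F : BoundedContinuousFunction (Y × Y) NNReal :=
      BoundedContinuousFunction.mkOfCompact
        ⟨fun z => (nndist z.1 z.2) ^ p.toReal,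
          (NNReal.continuous_rpow_const hpr.le).comp continuous_nndist⟩
    have hF (z : Y × Y) : ‖dist z.1 z.2‖ₑ ^ p.toReal = (F z : ℝ≥0∞) := by
      rw [hen, ← ENNReal.coe_rpow_of_nonneg _ hpr.le]; rfl
    simp only [hF] at hW ⊢
    exact le_of_tendsto (ProbabilityMeasure.tendsto_iff_forall_lintegral_tendsto.1 hconv F) hW

/-- convergence of couplings: if `ε_n ↘ 0` and `π_n` is optimal for the
alternative primal form of `W_p^{ε_n}(μ,ν)`, then a subsequence of `π_n` converges weakly
to an optimal coupling for `W_p(μ,ν)`. -/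
theorem optimal_near_couplings_converge {X : Type*} [MetricSpace X] [CompactSpace X]
    [MeasurableSpace X] [BorelSpace X]
    (p : ℝ≥0∞) (hp : 1 ≤ p)
    (μ ν : Measure X) [IsProbabilityMeasure μ] [IsProbabilityMeasure ν]
    (ε : ℕ → ℝ) (hanti : Antitone ε) (hpos : ∀ n, 0 ≤ ε n)
    (hlim : Tendsto ε atTop (𝓝 0))
    (π : ℕ → Measure (X × X)) (hprob : ∀ n, IsProbabilityMeasure (π n))
    (hfeas₁ : ∀ n, μ ∈ huberBall (ε n) ((π n).map Prod.fst))
    (hfeas₂ : ∀ n, ν ∈ huberBall (ε n) ((π n).map Prod.snd))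
    (hopt : ∀ n, eLpNorm (fun z : X × X => dist z.1 z.2) p (π n) = altPrimal p (ε n) μ ν) :
    ∃ φ : ℕ → ℕ, StrictMono φ ∧
      ∃ πlim : Measure (X × X),
        πlim.map Prod.fst = μ ∧ πlim.map Prod.snd = ν ∧
        eLpNorm (fun z : X × X => dist z.1 z.2) p πlim = Wp p μ ν ∧
        ∀ f : BoundedContinuousFunction (X × X) ℝ,
          Tendsto (fun k => ∫ z, f z ∂(π (φ k))) atTop (𝓝 (∫ z, f z ∂πlim)) := by
  have hle : ∀ n, ε n ≤ 1 → ∀ q ∈ couplings μ ν,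
      altPrimal p (ε n) μ ν ≤ eLpNorm (fun z : X × X => dist z.1 z.2) p q := by
    intro n hn q hq
    have hq1 : IsProbabilityMeasure q := by
      have h : IsProbabilityMeasure (q.map Prod.fst) := by rw [hq.1]; infer_instance
      exact (Measure.isProbabilityMeasure_map_iff measurable_fst.aemeasurable).1 h
    have hself (m : Measure X) [IsProbabilityMeasure m] : m ∈ huberBall (ε n) m := by
      refine ⟨m, inferInstance, ?_⟩
      rw [← add_smul, ← ofReal_add (by linarith) (hpos n)]
      simp
    refine iInf_le_of_le q (iInf_le_of_le hq1 (iInf_le_of_le ?_ (iInf_le_of_le ?_ le_rfl)))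
    · rw [hq.1]; exact hself μ
    · rw [hq.2]; exact hself ν
  have hsmall : ∀ᶠ n in atTop, ε n ≤ 1 := (hlim.eventually (gt_mem_nhds zero_lt_one)).mono
    fun _ h => le_of_lt h
  obtain ⟨Q, φ, hφ, hQ⟩ := CompactSpace.tendsto_subseq
    (X := ProbabilityMeasure (X × X)) (fun n => ⟨π n, hprob n⟩)
  have hconv : ∀ f : BoundedContinuousFunction (X × X) ℝ,
      Tendsto (fun k => ∫ z, f z ∂(π (φ k))) atTop (𝓝 (∫ z, f z ∂(Q : Measure (X × X)))) :=
    fun f => ProbabilityMeasure.tendsto_iff_forall_integral_tendsto.1 hQ f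
  have hlim' := hlim.comp hφ.tendsto_atTop
  have h1 := onc_marginal μ Prod.fst continuous_fst (ε ∘ φ) (fun n => hpos _) hlim'
    (fun k => π (φ k)) (fun k => hprob _) Q (fun k => hfeas₁ _) hconv
  have h2 := onc_marginal ν Prod.snd continuous_snd (ε ∘ φ) (fun n => hpos _) hlim'
    (fun k => π (φ k)) (fun k => hprob _) Q (fun k => hfeas₂ _) hconv
  refine ⟨φ, hφ, Q, h1, h2, le_antisymm ?_ (iInf₂_le _ ⟨h1, h2⟩), hconv⟩
  refine onc_lsc p hp _ Q hQ _ ?_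
  filter_upwards [hφ.tendsto_atTop.eventually hsmall] with k hk
  refine (hopt (φ k)).le.trans (le_iInf₂ (hle _ hk))

end
end

section
/- (Finite support.) Let (X,d) be a compact metric space, p ∈ [1,∞], and ε ∈ [0,1). Let μ and ν be uniform discrete probability measures over n points each. Then there exist optimal μ', ν' for the primal problem defining W_p^ε(μ,ν) such that μ' and ν' each assign mass 1/n to ⌊(1−ε)n⌋ points of the respective supports and assign their remaining ⌈εn⌉/n − ε mass to a single point. -/
open MeasureTheory ENNReal Filter Topology

noncomputable section

variable {X : Type*} [MetricSpace X] [MeasurableSpace X] [BorelSpace X]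

lemma aux_null {α β : Type*} (F : Finset α) (J : Finset β) (w : β → α → ℝ)
    (h : J.card < F.card) :
    ∃ δ : α → ℝ, δ ≠ 0 ∧ (∀ a, a ∉ F → δ a = 0) ∧ ∀ j ∈ J, ∑ a ∈ F, w j a * δ a = 0 := by
  classical
  let L : (F → ℝ) →ₗ[ℝ] (J → ℝ) :=
    { toFun := fun d j => ∑ a : F, w j a * d a
      map_add' := by intro x y; ext j; simp [mul_add, Finset.sum_add_distrib]
      map_smul' := by
        intro c x; ext j; simp [Finset.mul_sum]
        exact Finset.sum_congr rfl (fun a _ => by ring) }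
  have hk : LinearMap.ker L ≠ ⊥ := LinearMap.ker_ne_bot_of_finrank_lt (by simpa using h)
  obtain ⟨d, hd, hd0⟩ := (Submodule.ne_bot_iff _).1 hk
  refine ⟨fun a => if h : a ∈ F then d ⟨a, h⟩ else 0, ?_, ?_, ?_⟩
  · intro h0
    apply hd0
    ext a
    have := congrFun h0 a.1
    simpa using this
  · intro a ha; simp [ha]
  · intro j hj
    have := congrFun (LinearMap.mem_ker.1 hd) ⟨j, hj⟩
    rw [← Finset.sum_coe_sort]
    simpa [L] using this

lemma aux_count {α γ : Type*} [DecidableEq γ] (g : α → γ) (F : Finset α) (R G : Finset γ)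
    (hd : Disjoint R G) (hR : ∀ i ∈ R, 2 ≤ (F.filter (fun a => g a = i)).card)
    (hG : ∀ i ∈ G, 1 ≤ (F.filter (fun a => g a = i)).card) :
    2 * R.card + G.card ≤ F.card := by
  classical
  have h1 : ∑ i ∈ R ∪ G, (F.filter (fun a => g a = i)).card ≤ F.card := by
    rw [← Finset.card_biUnion]
    · apply Finset.card_le_card
      intro a ha
      simp only [Finset.mem_biUnion, Finset.mem_filter] at ha
      obtain ⟨_, _, h, _⟩ := ha
      exact h
    · intro x _ y _ hxy
      refine Finset.disjoint_left.2 ?_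
      intro a ha hb
      simp only [Finset.mem_filter] at ha hb
      exact hxy (ha.2.symm.trans hb.2)
  rw [Finset.sum_union hd] at h1
  have h2 := Finset.card_nsmul_le_sum R _ 2 hR
  have h3 := Finset.card_nsmul_le_sum G _ 1 hG
  simp only [smul_eq_mul] at h2 h3
  omega

lemma aux_ev (x y : ℝ) (hx : 0 ≤ x) (h : x = 0 → y = 0) :
    ∀ᶠ t in 𝓝[>] (0:ℝ), |t * y| ≤ x := by
  rcases hx.eq_or_lt with h0 | h0
  · simp [h h0.symm, ← h0]
  · have : Tendsto (fun t : ℝ => |t * y|) (𝓝[>] 0) (𝓝 |0 * y|) :=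
      ((by fun_prop : Continuous (fun t : ℝ => |t * y|)).tendsto 0).mono_left nhdsWithin_le_nhds
    rw [zero_mul, abs_zero] at this
    exact (this.eventually (gt_mem_nhds h0)).mono fun t ht => ht.le

/-- tight lines touching fractional entries have two of them -/
lemma aux_two {κ : Type*} [Fintype κ] [DecidableEq κ] (q : κ → ℝ) (h0 : ∀ j, 0 ≤ q j)
    (h1 : ∑ j, q j = 1) (j : κ) (hj0 : 0 < q j) (hj1 : q j < 1) :
    ∃ j', j' ≠ j ∧ 0 < q j' ∧ q j' < 1 := by
  have hs := Finset.add_sum_erase Finset.univ q (Finset.mem_univ j)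
  have hpos : 0 < ∑ x ∈ Finset.univ.erase j, q x := by linarith
  obtain ⟨j', hj', hq⟩ : ∃ j' ∈ Finset.univ.erase j, 0 < q j' := by
    by_contra! hcon
    linarith [Finset.sum_nonpos hcon]
  have := Finset.single_le_sum (f := q) (fun i _ => h0 i) hj'
  exact ⟨j', Finset.ne_of_mem_erase hj', hq, by linarith⟩

lemma aux_one {κ : Type*} [Fintype κ] (q : κ → ℝ) (h0 : ∀ j, 0 ≤ q j)
    (h1 : 0 < ∑ j, q j) (h2 : ∑ j, q j < 1) : ∃ j, 0 < q j ∧ q j < 1 := by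
  obtain ⟨j', hj', hq⟩ : ∃ j' ∈ Finset.univ, 0 < q j' := by
    by_contra! hcon
    linarith [Finset.sum_nonpos hcon]
  have := Finset.single_le_sum (f := q) (fun i _ => h0 i) hj'
  exact ⟨j', hq, by linarith⟩

lemma aux_pert {ι κ : Type*} [Fintype ι] [Fintype κ] [DecidableEq ι] [DecidableEq κ]
    (Q : ι → κ → ℝ) (h0 : ∀ i j, 0 ≤ Q i j) (hr : ∀ i, ∑ j, Q i j ≤ 1)
    (hc : ∀ j, ∑ i, Q i j ≤ 1) (i₁ i₂ : ι) (hne : i₁ ≠ i₂)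
    (ha : 0 < ∑ j, Q i₁ j) (ha' : ∑ j, Q i₁ j < 1)
    (hb : 0 < ∑ j, Q i₂ j) (hb' : ∑ j, Q i₂ j < 1) :
    ∃ δ : ι → κ → ℝ, δ ≠ 0 ∧ (∀ i j, |δ i j| ≤ Q i j) ∧
      (∀ i, |∑ j, δ i j| ≤ 1 - ∑ j, Q i j) ∧ (∀ j, |∑ i, δ i j| ≤ 1 - ∑ i, Q i j) ∧
      ∑ i, ∑ j, δ i j = 0 := by
  classical
  set F : Finset (ι × κ) := Finset.univ.filter (fun a => 0 < Q a.1 a.2 ∧ Q a.1 a.2 < 1) with hF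
  set R : Finset ι := Finset.univ.filter (fun i => ∑ j, Q i j = 1 ∧ ∃ j, (i, j) ∈ F) with hR
  set C : Finset κ := Finset.univ.filter (fun j => ∑ i, Q i j = 1 ∧ ∃ i, (i, j) ∈ F) with hC
  have hmF : ∀ i j, (i, j) ∈ F ↔ 0 < Q i j ∧ Q i j < 1 := by intro i j; simp [hF]
  have hR2 : ∀ i ∈ R, 2 ≤ (F.filter (fun a => a.1 = i)).card := by
    intro i hi
    simp only [hR, Finset.mem_filter, Finset.mem_univ, true_and] at hi
    obtain ⟨hi1, j, hj⟩ := hi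
    obtain ⟨j', hj', hq⟩ := aux_two (Q i) (h0 i) hi1 j ((hmF _ _).1 hj).1 ((hmF _ _).1 hj).2
    refine Finset.one_lt_card.2 ⟨(i, j), ?_, (i, j'), ?_, ?_⟩
    · simp [hj]
    · simp [(hmF i j').2 hq]
    · simp [hj'.symm]
  have hC2 : ∀ j ∈ C, 2 ≤ (F.filter (fun a => a.2 = j)).card := by
    intro j hj
    simp only [hC, Finset.mem_filter, Finset.mem_univ, true_and] at hj
    obtain ⟨hi1, i, hi⟩ := hj
    obtain ⟨i', hi', hq⟩ := aux_two (fun i => Q i j) (fun i => h0 i j) hi1 i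
      ((hmF _ _).1 hi).1 ((hmF _ _).1 hi).2
    refine Finset.one_lt_card.2 ⟨(i, j), ?_, (i', j), ?_, ?_⟩
    · simp [hi]
    · simp [(hmF i' j).2 hq]
    · simp [hi'.symm]
  have cR : 2 * R.card + 2 ≤ F.card := by
    have := aux_count (fun a : ι × κ => a.1) F R {i₁, i₂} ?_ hR2 ?_
    · rwa [Finset.card_pair hne] at this
    · rw [Finset.disjoint_right]
      intro i hi hi'
      simp only [hR, Finset.mem_filter, Finset.mem_univ, true_and] at hi'
      simp only [Finset.mem_insert, Finset.mem_singleton] at hi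
      rcases hi with rfl | rfl <;> linarith [hi'.1]
    · intro i hi
      simp only [Finset.mem_insert, Finset.mem_singleton] at hi
      have : ∃ j, 0 < Q i j ∧ Q i j < 1 := by
        rcases hi with rfl | rfl
        · exact aux_one _ (h0 _) ha ha'
        · exact aux_one _ (h0 _) hb hb'
      obtain ⟨j, hj⟩ := this
      exact Finset.card_pos.2 ⟨(i, j), by simp [(hmF i j).2 hj]⟩
  let w : Option (ι ⊕ κ) → ι × κ → ℝ := fun o a => match o with
    | none => 1
    | some (Sum.inl i) => if a.1 = i then 1 else 0
    | some (Sum.inr j) => if a.2 = j then 1 else 0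
  let J₀ : Finset (Option (ι ⊕ κ)) := (R.disjSum C).map Function.Embedding.some
  have hJ₀ : J₀.card = R.card + C.card := by simp [J₀]
  have key : ∃ δ : ι × κ → ℝ, δ ≠ 0 ∧ (∀ a, a ∉ F → δ a = 0) ∧
      (∀ j ∈ J₀, ∑ a ∈ F, w j a * δ a = 0) ∧
      ((∃ j, 0 < ∑ i, Q i j ∧ ∑ i, Q i j < 1) → ∑ a ∈ F, δ a = 0) := by
    by_cases hf : ∃ j, 0 < ∑ i, Q i j ∧ ∑ i, Q i j < 1
    · obtain ⟨j, hj0, hj1⟩ := hf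
      have cC : 2 * C.card + 1 ≤ F.card := by
        have := aux_count (fun a : ι × κ => a.2) F C {j} ?_ hC2 ?_
        · simpa using this
        · rw [Finset.disjoint_right]
          intro i hi hi'
          simp only [hC, Finset.mem_filter, Finset.mem_univ, true_and] at hi'
          simp only [Finset.mem_singleton] at hi
          subst hi
          linarith [hi'.1]
        · intro i hi
          simp only [Finset.mem_singleton] at hi
          subst hi
          obtain ⟨k, hk⟩ := aux_one _ (fun k => h0 k i) hj0 hj1
          exact Finset.card_pos.2 ⟨(k, i), by simp [(hmF k i).2 hk]⟩
      obtain ⟨δ, h1, h2, h3⟩ := aux_null F (insert none J₀) w (by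
        rw [Finset.card_insert_of_notMem (by simp [J₀])]; omega)
      refine ⟨δ, h1, h2, fun j hj => h3 j (Finset.mem_insert_of_mem hj), fun _ => ?_⟩
      simpa [w] using h3 none (Finset.mem_insert_self _ _)
    · have cC : 2 * C.card + 0 ≤ F.card := by
        have := aux_count (fun a : ι × κ => a.2) F C ∅ (by simp) hC2 (by simp)
        simpa using this
      obtain ⟨δ, h1, h2, h3⟩ := aux_null F J₀ w (by omega)
      exact ⟨δ, h1, h2, h3, fun h => absurd h hf⟩
  obtain ⟨δ, hδ0, hδF, hδJ, hδT⟩ := key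
  have hrow : ∀ i, ∑ j, Q i j = 1 → ∑ j, δ (i, j) = 0 := by
    intro i hi
    by_cases hiR : ∃ j, (i, j) ∈ F
    · have := hδJ (some (Sum.inl i)) (by simp [J₀, hR, hi, hiR])
      simp only [w] at this
      rw [Finset.sum_subset (Finset.subset_univ F) (by
        intro a _ haF; simp [hδF a haF]), Fintype.sum_prod_type, Finset.sum_eq_single i] at this
      · simpa using this
      · intro b _ hbi; simp [hbi]
      · simp
    · push Not at hiR
      exact Finset.sum_eq_zero fun j _ => hδF _ (hiR j)
  have hcol : ∀ j, ∑ i, Q i j = 1 → ∑ i, δ (i, j) = 0 := by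
    intro j hj
    by_cases hjC : ∃ i, (i, j) ∈ F
    · have := hδJ (some (Sum.inr j)) (by simp [J₀, hC, hj, hjC])
      simp only [w] at this
      rw [Finset.sum_subset (Finset.subset_univ F) (by
        intro a _ haF; simp [hδF a haF]), Fintype.sum_prod_type_right,
        Finset.sum_eq_single j] at this
      · simpa using this
      · intro b _ hbi; simp [hbi]
      · simp
    · push Not at hjC
      exact Finset.sum_eq_zero fun i _ => hδF _ (hjC i)
  have htot : ∑ i, ∑ j, δ (i, j) = 0 := by
    by_cases hf : ∃ j, 0 < ∑ i, Q i j ∧ ∑ i, Q i j < 1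
    · have := hδT hf
      rwa [Finset.sum_subset (Finset.subset_univ F) (by
        intro a _ haF; simp [hδF a haF]), Fintype.sum_prod_type] at this
    · push Not at hf
      rw [Finset.sum_comm]
      refine Finset.sum_eq_zero fun j _ => ?_
      rcases (Finset.sum_nonneg (fun i (_ : i ∈ Finset.univ) => h0 i j)).eq_or_lt with h | h
      · refine Finset.sum_eq_zero fun i _ => hδF _ fun hi => ?_
        have := (Finset.sum_eq_zero_iff_of_nonneg (fun i _ => h0 i j)).1 h.symm i
          (Finset.mem_univ i)
        linarith [((hmF i j).1 hi).1]
      · exact hcol j (le_antisymm (hc j) (hf j h))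
  have e1 : ∀ᶠ t in 𝓝[>] (0:ℝ), ∀ i j, |t * δ (i, j)| ≤ Q i j := by
    rw [eventually_all]; intro i
    rw [eventually_all]; intro j
    refine aux_ev _ _ (h0 i j) fun h => hδF _ fun hi => ?_
    linarith [((hmF i j).1 hi).1]
  have e2 : ∀ᶠ t in 𝓝[>] (0:ℝ), ∀ i, |t * ∑ j, δ (i, j)| ≤ 1 - ∑ j, Q i j := by
    rw [eventually_all]; intro i
    exact aux_ev _ _ (by linarith [hr i]) fun h => hrow i (by linarith)
  have e3 : ∀ᶠ t in 𝓝[>] (0:ℝ), ∀ j, |t * ∑ i, δ (i, j)| ≤ 1 - ∑ i, Q i j := by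
    rw [eventually_all]; intro i
    exact aux_ev _ _ (by linarith [hc i]) fun h => hcol i (by linarith)
  obtain ⟨t, ⟨ht1, ht2, ht3⟩, ht⟩ := ((e1.and (e2.and e3)).and self_mem_nhdsWithin).exists
  have ht : 0 < t := ht
  refine ⟨fun i j => t * δ (i, j), ?_, ht1, ?_, ?_, ?_⟩
  · intro h
    apply hδ0
    ext ⟨i, j⟩
    have := congrFun (congrFun h i) j
    simpa [ht.ne'] using this
  · simpa [Finset.mul_sum] using ht2
  · simpa [Finset.mul_sum] using ht3
  · simp_rw [← Finset.mul_sum, htot, mul_zero]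

def polyK (ι κ : Type*) [Fintype ι] [Fintype κ] (s : ℝ) : Set (ι → κ → ℝ) :=
  {Q | (∀ i j, 0 ≤ Q i j) ∧ (∀ i, ∑ j, Q i j ≤ 1) ∧ (∀ j, ∑ i, Q i j ≤ 1) ∧
    ∑ i, ∑ j, Q i j = s}

lemma polyK_compact (ι κ : Type*) [Fintype ι] [Fintype κ] (s : ℝ) :
    IsCompact (polyK ι κ s) := by
  have hsub : polyK ι κ s ⊆ Set.Icc 0 1 := by
    rintro Q ⟨h0, hr, _, _⟩
    refine ⟨fun i j => h0 i j, fun i j => ?_⟩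
    exact (Finset.single_le_sum (fun j _ => h0 i j) (Finset.mem_univ j)).trans (hr i)
  refine isCompact_Icc.of_isClosed_subset ?_ hsub
  have : polyK ι κ s = (⋂ i, ⋂ j, {Q | 0 ≤ Q i j}) ∩ ((⋂ i, {Q | ∑ j, Q i j ≤ 1}) ∩
    ((⋂ j, {Q | ∑ i, Q i j ≤ 1}) ∩ {Q | ∑ i, ∑ j, Q i j = s})) := by
    ext Q; simp [polyK]
  rw [this]
  refine (isClosed_iInter fun i => isClosed_iInter fun j =>
    isClosed_le (by fun_prop) (by fun_prop)).inter
    ((isClosed_iInter fun i => isClosed_le (by fun_prop) (by fun_prop)).inter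
    ((isClosed_iInter fun i => isClosed_le (by fun_prop) (by fun_prop)).inter
    (isClosed_eq (by fun_prop) (by fun_prop))))

lemma aux_ext_s15 {ι κ : Type*} [Fintype ι] [Fintype κ] {s : ℝ} {Q δ : ι → κ → ℝ}
    (hQ : Q ∈ (polyK ι κ s).extremePoints ℝ) (h1 : ∀ i j, |δ i j| ≤ Q i j)
    (h2 : ∀ i, |∑ j, δ i j| ≤ 1 - ∑ j, Q i j) (h3 : ∀ j, |∑ i, δ i j| ≤ 1 - ∑ i, Q i j)
    (h4 : ∑ i, ∑ j, δ i j = 0) : δ = 0 := by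
  obtain ⟨⟨q0, qr, qc, qs⟩, hext⟩ := hQ
  have hp : Q + δ ∈ polyK ι κ s := by
    refine ⟨fun i j => ?_, fun i => ?_, fun j => ?_, ?_⟩
    · simp only [Pi.add_apply]; linarith [(abs_le.1 (h1 i j)).1]
    · simp only [Pi.add_apply, Finset.sum_add_distrib]; linarith [(abs_le.1 (h2 i)).2]
    · simp only [Pi.add_apply, Finset.sum_add_distrib]; linarith [(abs_le.1 (h3 j)).2]
    · simp only [Pi.add_apply, Finset.sum_add_distrib]; linarith
  have hm : Q - δ ∈ polyK ι κ s := by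
    refine ⟨fun i j => ?_, fun i => ?_, fun j => ?_, ?_⟩
    · simp only [Pi.sub_apply]; linarith [(abs_le.1 (h1 i j)).2]
    · simp only [Pi.sub_apply, Finset.sum_sub_distrib]; linarith [(abs_le.1 (h2 i)).1]
    · simp only [Pi.sub_apply, Finset.sum_sub_distrib]; linarith [(abs_le.1 (h3 j)).1]
    · simp only [Pi.sub_apply, Finset.sum_sub_distrib]; linarith
  have := hext hp hm ⟨1/2, 1/2, by norm_num, by norm_num, by norm_num, by
    ext i j; simp; ring⟩
  simpa using this

lemma aux_comb {ι κ : Type*} [Fintype ι] [Fintype κ] (s : ℝ) (P c : ι → κ → ℝ)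
    (hP : P ∈ polyK ι κ s) :
    ∃ Q ∈ polyK ι κ s, ∑ i, ∑ j, c i j * Q i j ≤ ∑ i, ∑ j, c i j * P i j ∧
      (∀ i₁ i₂, 0 < ∑ j, Q i₁ j → ∑ j, Q i₁ j < 1 → 0 < ∑ j, Q i₂ j → ∑ j, Q i₂ j < 1 →
        i₁ = i₂) ∧
      (∀ j₁ j₂, 0 < ∑ i, Q i j₁ → ∑ i, Q i j₁ < 1 → 0 < ∑ i, Q i j₂ → ∑ i, Q i j₂ < 1 →
        j₁ = j₂) := by
  classical
  let l : (ι → κ → ℝ) →ₗ[ℝ] ℝ :=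
    { toFun := fun Q => -∑ i, ∑ j, c i j * Q i j
      map_add' := by
        intro x y; simp only [Pi.add_apply, mul_add, Finset.sum_add_distrib]; ring
      map_smul' := by
        intro a x
        simp only [Pi.smul_apply, smul_eq_mul, RingHom.id_apply, mul_neg, Finset.mul_sum]
        congr 1
        exact Finset.sum_congr rfl fun i _ => Finset.sum_congr rfl fun j _ => by ring }
  let lc : StrongDual ℝ (ι → κ → ℝ) := ⟨l, by
    change Continuous fun Q : ι → κ → ℝ => -∑ i, ∑ j, c i j * Q i j
    fun_prop⟩
  have hexp : IsExposed ℝ (polyK ι κ s) (lc.toExposed (polyK ι κ s)) :=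
    ContinuousLinearMap.toExposed.isExposed
  have hcomp := hexp.isCompact (polyK_compact ι κ s)
  obtain ⟨Q₀, hQ₀, hmax⟩ := (polyK_compact ι κ s).exists_isMaxOn ⟨P, hP⟩ lc.continuous.continuousOn
  obtain ⟨Q, hQ⟩ := hcomp.extremePoints_nonempty ⟨Q₀, hQ₀, hmax⟩
  have hQK : Q ∈ (polyK ι κ s).extremePoints ℝ :=
    hexp.isExtreme.extremePoints_subset_extremePoints hQ
  have hle : lc P ≤ lc Q := hQ.1.2 P hP
  obtain ⟨q0, qr, qc, qs⟩ := hQK.1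
  refine ⟨Q, hQK.1, ?_, ?_, ?_⟩
  · have : -∑ i, ∑ j, c i j * P i j ≤ -∑ i, ∑ j, c i j * Q i j := hle
    linarith
  · intro i₁ i₂ a b c d
    by_contra hne
    obtain ⟨δ, hδ, h1, h2, h3, h4⟩ := aux_pert Q q0 qr qc i₁ i₂ hne a b c d
    exact hδ (aux_ext_s15 hQK h1 h2 h3 h4)
  · intro i₁ i₂ a b c d
    by_contra hne
    obtain ⟨δ, hδ, h1, h2, h3, h4⟩ := aux_pert (fun j i => Q i j) (fun j i => q0 i j)
      qc qr i₁ i₂ hne a b c d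
    have := aux_ext_s15 (δ := fun i j => δ j i) hQK (fun i j => h1 j i) h3 h2
      (by rw [Finset.sum_comm]; exact h4)
    apply hδ
    ext i j
    exact congrFun (congrFun this j) i

lemma aux_shape {ι : Type*} [Fintype ι] [Nonempty ι] (r : ι → ℝ) (s : ℝ) (h0 : ∀ i, 0 ≤ r i)
    (h1 : ∀ i, r i ≤ 1) (hs : ∑ i, r i = s)
    (hu : ∀ i₁ i₂, 0 < r i₁ → r i₁ < 1 → 0 < r i₂ → r i₂ < 1 → i₁ = i₂) :
    ∃ (A : Finset ι) (x₀ : ι), A.card = ⌊s⌋₊ ∧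
      ∀ i, r i = Set.indicator (A : Set ι) 1 i + Set.indicator {x₀} (fun _ => s - ⌊s⌋₊) i := by
  classical
  set A : Finset ι := Finset.univ.filter (fun i => r i = 1) with hA
  by_cases hf : ∃ i, 0 < r i ∧ r i < 1
  · obtain ⟨x, hx0, hx1⟩ := hf
    have hr : ∀ i, r i = (if i ∈ A then 1 else 0) + (if i = x then r x else 0) := by
      intro i
      by_cases hi : i = x
      · subst hi; simp [hA, hx1.ne]
      · by_cases h : r i = 1
        · simp [hA, h, hi]
        · have : r i = 0 := by
            by_contra h'
            exact hi (hu i x ((h0 i).lt_of_ne' h') ((h1 i).lt_of_ne h) hx0 hx1)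
          simp [hA, hi, this]
    have hsum : s = A.card + r x := by
      rw [← hs, Finset.sum_congr rfl (fun i _ => hr i), Finset.sum_add_distrib]
      simp
    have hfl : ⌊s⌋₊ = A.card := by
      rw [Nat.floor_eq_iff (hs ▸ Finset.sum_nonneg fun i _ => h0 i)]
      constructor <;> linarith
    refine ⟨A, x, hfl.symm, fun i => ?_⟩
    rw [hfl, hsum, hr i]
    simp [Set.indicator_apply]
  · push Not at hf
    have hr : ∀ i, r i = (if i ∈ A then 1 else 0) := by
      intro i
      rcases (h0 i).eq_or_lt with h | h
      · simp [hA, h.symm]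
      · have := le_antisymm (h1 i) (hf i h)
        simp [hA, this]
    have hsum : s = A.card := by
      rw [← hs, Finset.sum_congr rfl (fun i _ => hr i)]
      simp
    refine ⟨A, Classical.arbitrary ι, by rw [hsum, Nat.floor_natCast], fun i => ?_⟩
    rw [hr i, hsum]
    simp [Set.indicator_apply]

/-- discrete measure with weights `r / n` -/
def discM (S : Finset X) (n : ℕ) (r : S → ℝ) : Measure X :=
  ∑ x : S, ENNReal.ofReal (r x / n) • Measure.dirac x.1

/-- discrete plan with weights `Q / s` -/
def discP (S T : Finset X) (s : ℝ) (Q : S → T → ℝ) : Measure (X × X) :=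
  ∑ x : S, ∑ y : T, ENNReal.ofReal (Q x y / s) • Measure.dirac (x.1, y.1)

lemma discM_univ (S : Finset X) (n : ℕ) (hn : 0 < n) (ε : ℝ) (r : S → ℝ) (h0 : ∀ i, 0 ≤ r i)
    (hs : ∑ i, r i = (1 - ε) * n) : discM S n r Set.univ = ENNReal.ofReal (1 - ε) := by
  have hn' : (0:ℝ) < n := by exact_mod_cast hn
  simp only [discM, Measure.coe_finsetSum, Finset.sum_apply, Measure.smul_apply, measure_univ,
    smul_eq_mul, mul_one]
  rw [← ENNReal.ofReal_sum_of_nonneg (fun i _ => div_nonneg (h0 i) hn'.le), ← Finset.sum_div, hs]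
  congr 1; field_simp

lemma unif_eq (S : Finset X) (n : ℕ) (hn : 0 < n) :
    (n : ℝ≥0∞)⁻¹ • ∑ x ∈ S, Measure.dirac x = discM S n (fun _ => 1) := by
  have hn' : (0:ℝ) < n := by exact_mod_cast hn
  rw [discM, ← Finset.sum_coe_sort, Finset.smul_sum]
  refine Finset.sum_congr rfl fun x _ => ?_
  congr 1
  rw [one_div, ENNReal.ofReal_inv_of_pos hn', ENNReal.ofReal_natCast]

lemma discM_mono (S : Finset X) (n : ℕ) (r r' : S → ℝ) (h : ∀ i, r i ≤ r' i) :
    discM S n r ≤ discM S n r' := by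
  refine Measure.le_iff.2 fun E _ => ?_
  simp only [discM, Measure.coe_finsetSum, Finset.sum_apply, Measure.smul_apply, smul_eq_mul]
  gcongr
  exact h _

lemma discM_shape (S : Finset X) (n : ℕ) (ε : ℝ) (hε0 : 0 ≤ ε) (hε1 : ε < 1) (hn : 0 < n)
    (r : S → ℝ) (A : Finset S) (x₀ : S)
    (h : ∀ i, r i = Set.indicator (A : Set S) 1 i +
      Set.indicator {x₀} (fun _ => (1 - ε) * n - ⌊(1 - ε) * n⌋₊) i) :
    discM S n r = (n : ℝ≥0∞)⁻¹ • ∑ x ∈ A.map (Function.Embedding.subtype _), Measure.dirac x +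
          ENNReal.ofReal ((⌈ε * n⌉₊ : ℝ) / n - ε) • Measure.dirac x₀.1 := by
  classical
  have hn' : (0:ℝ) < n := by exact_mod_cast hn
  have hs : (0:ℝ) ≤ (1 - ε) * n := by have : 0 < 1 - ε := by linarith
                                      positivity
  have hfl : ((⌊(1 - ε) * n⌋₊ : ℕ) : ℝ) = n - ⌈ε * n⌉₊ := by
    have hle : ⌈ε * n⌉₊ ≤ n := Nat.ceil_le.2 (by nlinarith)
    rw [← Nat.cast_sub hle]
    congr 1
    rw [Nat.floor_eq_iff hs, Nat.cast_sub hle]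
    have h1 := Nat.le_ceil (ε * n)
    have h2 := Nat.ceil_lt_add_one (a := ε * n) (by positivity)
    constructor <;> nlinarith
  have hfr := Nat.floor_le hs
  have hcoef : ∀ i : S, ENNReal.ofReal (r i / n) = (if i ∈ A then (n : ℝ≥0∞)⁻¹ else 0) +
      (if i = x₀ then ENNReal.ofReal ((⌈ε * n⌉₊ : ℝ) / n - ε) else 0) := by
    intro i
    rw [h i, add_div, ENNReal.ofReal_add]
    · congr 1
      · by_cases hi : i ∈ A
        · simp [hi, ENNReal.ofReal_inv_of_pos hn']
        · simp [hi]
      · by_cases hi : i = x₀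
        · simp only [hi, Set.mem_singleton_iff, Set.indicator_of_mem, if_true]
          congr 1
          rw [hfl]; field_simp; ring
        · simp [hi]
    · exact div_nonneg (Set.indicator_nonneg (fun _ _ => zero_le_one) _) hn'.le
    · exact div_nonneg (Set.indicator_nonneg (fun _ _ => by linarith) _) hn'.le
  rw [discM]
  simp_rw [hcoef, add_smul, Finset.sum_add_distrib, ite_smul, zero_smul]
  congr 1
  · rw [← Finset.sum_filter, Finset.filter_mem_eq_inter, Finset.univ_inter, Finset.sum_map,
      Finset.smul_sum]
    rfl
  · simp

lemma sub_univ (μ μ' : Measure X) [IsFiniteMeasure μ] (h : μ' ≤ μ) :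
    (μ - μ') Set.univ = μ Set.univ - μ' Set.univ := by
  have : IsFiniteMeasure μ' := isFiniteMeasure_of_le μ h
  exact Measure.sub_apply MeasurableSet.univ h

lemma discP_coupling (S T : Finset X) (n : ℕ) (hn : 0 < n) (ε : ℝ) (hε1 : ε < 1)
    (Q : S → T → ℝ) (hQ : Q ∈ polyK S T ((1 - ε) * n)) :
    discP S T ((1 - ε) * n) Q ∈ couplings
      ((discM S n (fun i => ∑ j, Q i j) Set.univ)⁻¹ • discM S n (fun i => ∑ j, Q i j))
      ((discM T n (fun j => ∑ i, Q i j) Set.univ)⁻¹ • discM T n (fun j => ∑ i, Q i j)) := by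
  obtain ⟨q0, qr, qc, qs⟩ := hQ
  have hn' : (0:ℝ) < n := by exact_mod_cast hn
  have hε : 0 < 1 - ε := by linarith
  rw [discM_univ S n hn ε _ (fun i => Finset.sum_nonneg fun j _ => q0 i j) qs,
    discM_univ T n hn ε _ (fun j => Finset.sum_nonneg fun i _ => q0 i j)
      (by rw [Finset.sum_comm]; exact qs)]
  have hco : ∀ {γ : Type _} [Fintype γ] (q : γ → ℝ), (∀ j, 0 ≤ q j) →
      (ENNReal.ofReal (1 - ε))⁻¹ * ENNReal.ofReal ((∑ j, q j) / n) =
      ∑ j, ENNReal.ofReal (q j / ((1 - ε) * n)) := by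
    intro γ _ q hq
    rw [← ENNReal.ofReal_sum_of_nonneg (fun i _ => div_nonneg (hq i) (by positivity)),
      ← Finset.sum_div, ← ENNReal.ofReal_inv_of_pos hε, ← ENNReal.ofReal_mul (by positivity)]
    congr 1; field_simp
  constructor
  · ext E hE
    rw [Measure.map_apply measurable_fst hE]
    simp only [discM, discP, Measure.coe_finsetSum, Finset.sum_apply, Measure.smul_apply,
      smul_eq_mul, Finset.mul_sum, ← mul_assoc]
    refine Finset.sum_congr rfl fun i _ => ?_
    rw [hco (Q i) (q0 i), Finset.sum_mul]
    refine Finset.sum_congr rfl fun j _ => ?_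
    rw [Measure.dirac_apply' _ (measurable_fst hE), Measure.dirac_apply' _ hE]
    rfl
  · ext E hE
    rw [Measure.map_apply measurable_snd hE]
    simp only [discM, discP, Measure.coe_finsetSum, Finset.sum_apply, Measure.smul_apply,
      smul_eq_mul, Finset.mul_sum, ← mul_assoc]
    rw [Finset.sum_comm]
    refine Finset.sum_congr rfl fun j _ => ?_
    rw [hco (fun i => Q i j) (fun i => q0 i j), Finset.sum_mul]
    refine Finset.sum_congr rfl fun i _ => ?_
    rw [Measure.dirac_apply' _ (measurable_snd hE), Measure.dirac_apply' _ hE]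
    rfl

lemma cost_mono (S T : Finset X) (s : ℝ) (hs : 0 < s) (p : ℝ≥0∞) (hp : 1 ≤ p) (P : S → T → ℝ)
    (hP : ∀ i j, 0 ≤ P i j) :
    ∃ c : S → T → ℝ, ∀ Q : S → T → ℝ, (∀ i j, 0 ≤ Q i j) →
      ∑ i, ∑ j, c i j * Q i j ≤ ∑ i, ∑ j, c i j * P i j →
      eLpNorm (fun z : X × X => dist z.1 z.2) p (discP S T s Q) ≤
        eLpNorm (fun z : X × X => dist z.1 z.2) p (discP S T s P) := by
  classical
  by_cases hpt : p = ∞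
  · subst hpt
    refine ⟨fun i j => if 0 < P i j then 0 else 1, fun Q hQ hc => ?_⟩
    have hz : ∑ i, ∑ j, (if 0 < P i j then (0:ℝ) else 1) * P i j = 0 := by
      refine Finset.sum_eq_zero fun i _ => Finset.sum_eq_zero fun j _ => ?_
      split_ifs with h
      · simp
      · simp [le_antisymm (not_lt.1 h) (hP i j)]
    rw [hz] at hc
    have hnn : ∀ i j, 0 ≤ (if 0 < P i j then (0:ℝ) else 1) * Q i j := fun i j =>
      mul_nonneg (by split_ifs <;> simp) (hQ i j)
    have h0 := le_antisymm hc (Finset.sum_nonneg fun i _ => Finset.sum_nonneg fun j _ => hnn i j)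
    rw [Finset.sum_eq_zero_iff_of_nonneg (fun i _ => Finset.sum_nonneg fun j _ => hnn i j)] at h0
    have hsup : ∀ i j, ¬ 0 < P i j → Q i j = 0 := by
      intro i j h
      have := (Finset.sum_eq_zero_iff_of_nonneg (fun j _ => hnn i j)).1
        (h0 i (Finset.mem_univ i)) j (Finset.mem_univ j)
      simpa [h] using this
    have hac : discP S T s Q ≪ discP S T s P := by
      refine Measure.AbsolutelyContinuous.mk fun E _ hE => ?_
      simp only [discP, Measure.coe_finsetSum, Finset.sum_apply, Measure.smul_apply,
        smul_eq_mul, Finset.sum_eq_zero_iff, Finset.mem_univ, true_imp_iff] at hE ⊢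
      intro i j
      by_cases h : 0 < P i j
      · rcases mul_eq_zero.1 (hE i j) with h' | h'
        · have := div_pos h hs
          simp only [ENNReal.ofReal_eq_zero] at h'
          linarith
        · simp [h']
      · simp [hsup i j h]
    rw [eLpNorm_exponent_top, eLpNorm_exponent_top]
    exact eLpNormEssSup_mono_measure _ hac
  · have hp0 : p ≠ 0 := by rintro rfl; simp at hp
    refine ⟨fun i j => dist i.1 j.1 ^ p.toReal, fun Q hQ hc => ?_⟩
    have key : ∀ R : S → T → ℝ, (∀ i j, 0 ≤ R i j) →
        ∫⁻ z, ‖dist z.1 z.2‖ₑ ^ p.toReal ∂(discP S T s R) =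
        ENNReal.ofReal ((∑ i, ∑ j, dist i.1 j.1 ^ p.toReal * R i j) / s) := by
      intro R hR
      have hnn : ∀ (i : S) (j : T), 0 ≤ dist i.1 j.1 ^ p.toReal * R i j / s := fun i j =>
        div_nonneg (mul_nonneg (Real.rpow_nonneg dist_nonneg _) (hR i j)) hs.le
      simp only [discP, lintegral_finsetSum_measure, lintegral_smul_measure, lintegral_dirac,
        Finset.sum_div, smul_eq_mul]
      rw [ENNReal.ofReal_sum_of_nonneg (fun i _ => Finset.sum_nonneg fun j _ => hnn i j)]
      refine Finset.sum_congr rfl fun i _ => ?_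
      rw [ENNReal.ofReal_sum_of_nonneg (fun j _ => hnn i j)]
      refine Finset.sum_congr rfl fun j _ => ?_
      rw [Real.enorm_of_nonneg dist_nonneg, ENNReal.ofReal_rpow_of_nonneg dist_nonneg
        ENNReal.toReal_nonneg, ← ENNReal.ofReal_mul (div_nonneg (hR i j) hs.le)]
      congr 1; ring
    rw [eLpNorm_eq_lintegral_rpow_enorm_toReal hp0 hpt,
      eLpNorm_eq_lintegral_rpow_enorm_toReal hp0 hpt, key Q hQ, key P hP]
    gcongr

/-- a plan whose marginals are dominated by discrete measures is discrete -/
lemma plan_eq (S T : Finset X) (π : Measure (X × X)) (hS : π (Prod.fst ⁻¹' (S : Set X)ᶜ) = 0)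
    (hT : π (Prod.snd ⁻¹' (T : Set X)ᶜ) = 0) :
    π = ∑ x : S, ∑ y : T, π {(x.1, y.1)} • Measure.dirac (x.1, y.1) := by
  classical
  have hr : π.restrict ((S ×ˢ T : Finset (X × X)) : Set (X × X)) = π := by
    refine Measure.restrict_eq_self_of_ae_mem ?_
    filter_upwards [measure_eq_zero_iff_ae_notMem.1 hS, measure_eq_zero_iff_ae_notMem.1 hT]
      with z h1 h2
    simp at h1 h2
    simp [h1, h2]
  ext E hE
  conv_lhs => rw [← hr, ← lintegral_indicator_one hE, lintegral_finset]
  rw [Finset.sum_product]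
  simp only [Measure.coe_finsetSum, Finset.sum_apply, Measure.smul_apply, smul_eq_mul]
  rw [← Finset.sum_coe_sort]
  refine Finset.sum_congr rfl fun i _ => ?_
  rw [← Finset.sum_coe_sort]
  refine Finset.sum_congr rfl fun j _ => ?_
  rw [Measure.dirac_apply' _ hE, mul_comm]

lemma plan_disc (S T : Finset X) (n : ℕ) (hn : 0 < n) (ε : ℝ) (hε1 : ε < 1)
    (π : Measure (X × X)) (hS : π (Prod.fst ⁻¹' (S : Set X)ᶜ) = 0)
    (hT : π (Prod.snd ⁻¹' (T : Set X)ᶜ) = 0) (hu : π Set.univ = 1)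
    (hr : ∀ x ∈ S, π (Prod.fst ⁻¹' {x}) ≤ ENNReal.ofReal (((1 - ε) * n)⁻¹))
    (hc : ∀ y ∈ T, π (Prod.snd ⁻¹' {y}) ≤ ENNReal.ofReal (((1 - ε) * n)⁻¹)) :
    ∃ P ∈ polyK S T ((1 - ε) * n), π = discP S T ((1 - ε) * n) P := by
  classical
  have hn' : (0:ℝ) < n := by exact_mod_cast hn
  have hε : 0 < 1 - ε := by linarith
  have hs : 0 < (1 - ε) * n := by positivity
  set s := (1 - ε) * n with hsdef
  have hfin : IsFiniteMeasure π := ⟨by simp [hu]⟩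
  have hpi := plan_eq S T π hS hT
  refine ⟨fun x y => s * π.real {(x.1, y.1)}, ⟨?_, ?_, ?_, ?_⟩, ?_⟩
  · intro i j; positivity
  · intro i
    rw [← Finset.mul_sum]
    have h1 : ∑ j : T, π.real {(i.1, j.1)} ≤ π.real (Prod.fst ⁻¹' {i.1}) := by
      rw [Finset.sum_coe_sort T (fun j => π.real {(i.1, j)})]
      have := measureReal_biUnion_finset (μ := π) (s := T) (f := fun j => {(i.1, j)})
        (by intro a _ b _ hab; simp [Function.onFun, hab]) (fun b _ => measurableSet_singleton _)
      rw [← this]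
      exact measureReal_mono (by intro z hz; simp at hz; obtain ⟨j, hj, rfl⟩ := hz; simp)
    have h2 : π.real (Prod.fst ⁻¹' {i.1}) ≤ s⁻¹ :=
      ENNReal.toReal_le_of_le_ofReal (by positivity) (hr i.1 i.2)
    calc _ ≤ s * s⁻¹ := by gcongr; exact h1.trans h2
      _ = 1 := mul_inv_cancel₀ hs.ne'
  · intro j
    rw [← Finset.mul_sum]
    have h1 : ∑ i : S, π.real {(i.1, j.1)} ≤ π.real (Prod.snd ⁻¹' {j.1}) := by
      rw [Finset.sum_coe_sort S (fun i => π.real {(i, j.1)})]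
      have := measureReal_biUnion_finset (μ := π) (s := S) (f := fun i => {(i, j.1)})
        (by intro a _ b _ hab; simp [Function.onFun, hab]) (fun b _ => measurableSet_singleton _)
      rw [← this]
      exact measureReal_mono (by intro z hz; simp at hz; obtain ⟨j, hj, rfl⟩ := hz; simp)
    have h2 : π.real (Prod.snd ⁻¹' {j.1}) ≤ s⁻¹ :=
      ENNReal.toReal_le_of_le_ofReal (by positivity) (hc j.1 j.2)
    calc _ ≤ s * s⁻¹ := by gcongr; exact h1.trans h2
      _ = 1 := mul_inv_cancel₀ hs.ne'
  · simp_rw [← Finset.mul_sum]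
    have h1 := congrArg (fun m : Measure (X × X) => (m Set.univ).toReal) hpi
    simp only [hu, Measure.coe_finsetSum, Finset.sum_apply, Measure.smul_apply, measure_univ,
      smul_eq_mul, mul_one] at h1
    rw [ENNReal.toReal_sum (fun i _ => by
      exact (ENNReal.sum_lt_top.2 fun j _ => measure_lt_top _ _).ne)] at h1
    have h2 : ∑ i : S, ∑ j : T, π.real {(i.1, j.1)} = 1 := by
      rw [ENNReal.toReal_one] at h1
      rw [h1]
      refine Finset.sum_congr rfl fun i _ => ?_
      rw [ENNReal.toReal_sum (fun j _ => (measure_lt_top _ _).ne)]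
      rfl
    rw [h2, mul_one]
  · conv_lhs => rw [hpi]
    rw [discP]
    refine Finset.sum_congr rfl fun i _ => Finset.sum_congr rfl fun j _ => ?_
    rw [mul_div_cancel_left₀ _ hs.ne']
    simp [Measure.real]

/-- marginal facts -/
lemma marg (S : Finset X) (n : ℕ) (hn : 0 < n) (hS : S.card = n) (ε : ℝ)
    (hε0 : 0 ≤ ε) (hε1 : ε < 1)
    (μ' : Measure X) (h : μ' ≤ discM S n (fun _ => 1))
    (hm : (discM S n (fun _ => 1) - μ') Set.univ ≤ ENNReal.ofReal ε) :
    ((μ' Set.univ)⁻¹ • μ') (S : Set X)ᶜ = 0 ∧ ((μ' Set.univ)⁻¹ • μ') Set.univ = 1 ∧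
    ∀ x ∈ S, ((μ' Set.univ)⁻¹ • μ') {x} ≤ ENNReal.ofReal (((1 - ε) * n)⁻¹) := by
  classical
  have hn' : (0:ℝ) < n := by exact_mod_cast hn
  have hε : 0 < 1 - ε := by linarith
  have hu : discM S n (fun _ => 1) Set.univ = 1 := by
    rw [discM_univ S n hn 0 _ (fun _ => zero_le_one) (by simp [hS])]; simp
  have : IsFiniteMeasure (discM S n (fun _ => 1)) := ⟨by simp [hu]⟩
  have : IsFiniteMeasure μ' := isFiniteMeasure_of_le _ h
  rw [sub_univ _ _ h, hu] at hm
  have hlow : ENNReal.ofReal (1 - ε) ≤ μ' Set.univ := by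
    rw [ENNReal.ofReal_sub _ hε0, ENNReal.ofReal_one]
    rw [tsub_le_iff_right] at hm ⊢
    rwa [add_comm]
  have hpos : μ' Set.univ ≠ 0 := by
    have : 0 < ENNReal.ofReal (1 - ε) := by simpa using hε1
    exact (this.trans_le hlow).ne'
  refine ⟨?_, ?_, ?_⟩
  · have : discM S n (fun _ => 1) (S : Set X)ᶜ = 0 := by
      simp [discM]
    simp [le_antisymm ((h _).trans this.le) zero_le]
  · simp only [Measure.smul_apply, smul_eq_mul]
    exact ENNReal.inv_mul_cancel hpos (measure_ne_top _ _)
  · intro x hx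
    have h1 : discM S n (fun _ => 1) {x} = ENNReal.ofReal (1 / n) := by
      simp only [discM, Measure.coe_finsetSum, Finset.sum_apply, Measure.smul_apply, smul_eq_mul]
      rw [Finset.sum_eq_single ⟨x, hx⟩]
      · simp
      · intro b _ hb
        have : b.1 ≠ x := fun h => hb (Subtype.ext h)
        simp [this]
      · simp
    simp only [Measure.smul_apply, smul_eq_mul]
    rw [mul_inv, ENNReal.ofReal_mul (by positivity), ENNReal.ofReal_inv_of_pos hε]
    refine mul_le_mul' (ENNReal.inv_le_inv.2 hlow) ?_
    rw [← one_div]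
    exact (h _).trans h1.le

/-- the admissible shape -/
def goodShape (S : Finset X) (n : ℕ) (ε : ℝ) (μ' : Measure X) : Prop :=
  ∃ A : Finset X, A ⊆ S ∧ A.card = ⌊(1 - ε) * n⌋₊ ∧ ∃ x₀ ∈ S,
        μ' = (n : ℝ≥0∞)⁻¹ • ∑ x ∈ A, Measure.dirac x +
          ENNReal.ofReal ((⌈ε * n⌉₊ : ℝ) / n - ε) • Measure.dirac x₀

lemma goodShape_finite (S : Finset X) (n : ℕ) (ε : ℝ) :
    {μ' : Measure X | goodShape S n ε μ'}.Finite := by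
  refine ((S.powerset ×ˢ S).finite_toSet.image (fun q : Finset X × X =>
    (n : ℝ≥0∞)⁻¹ • ∑ x ∈ q.1, Measure.dirac x +
          ENNReal.ofReal ((⌈ε * n⌉₊ : ℝ) / n - ε) • Measure.dirac q.2)).subset ?_
  rintro μ' ⟨A, hA, _, x₀, hx, rfl⟩
  exact ⟨(A, x₀), by simp [hA, hx], rfl⟩

lemma good_of_rows (S : Finset X) (n : ℕ) (hn : 0 < n) (hS : S.card = n) (ε : ℝ)
    (hε0 : 0 ≤ ε) (hε1 : ε < 1) (r : S → ℝ) (h0 : ∀ i, 0 ≤ r i)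
    (h1 : ∀ i, r i ≤ 1) (hs : ∑ i, r i = (1 - ε) * n)
    (hu : ∀ i₁ i₂, 0 < r i₁ → r i₁ < 1 → 0 < r i₂ → r i₂ < 1 → i₁ = i₂) :
    discM S n r ≤ discM S n (fun _ => 1) ∧
    (discM S n (fun _ => 1) - discM S n r) Set.univ ≤ ENNReal.ofReal ε ∧
    goodShape S n ε (discM S n r) := by
  have hu1 : discM S n (fun _ => 1) Set.univ = 1 := by
    rw [discM_univ S n hn 0 _ (fun _ => zero_le_one) (by simp [hS])]; simp
  have : IsFiniteMeasure (discM S n (fun _ => 1)) := ⟨by simp [hu1]⟩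
  have hle := discM_mono S n r _ h1
  refine ⟨hle, ?_, ?_⟩
  · rw [sub_univ _ _ hle, hu1, discM_univ S n hn ε r h0 hs, ← ENNReal.ofReal_one,
      ← ENNReal.ofReal_sub _ (by linarith)]
    simp
  · have : Nonempty S := by
      rw [Finset.nonempty_coe_sort, ← Finset.card_pos]; omega
    obtain ⟨A, x₀, hA, hr⟩ := aux_shape r _ h0 h1 hs hu
    refine ⟨A.map (Function.Embedding.subtype _), ?_, by simpa using hA, x₀.1, x₀.2,
      discM_shape S n ε hε0 hε1 hn r A x₀ hr⟩
    intro x hx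
    simp at hx
    exact hx.1

/-- finite support: for uniform discrete measures `μ, ν` over `n` points
each, there exist optimal `μ', ν'` for the primal problem defining `W_p^ε(μ,ν)` assigning
mass `1/n` to `⌊(1−ε)n⌋` support points and the remaining `⌈εn⌉/n − ε` mass to a single
point. -/
theorem RWp_finite_support {X : Type*} [MetricSpace X] [CompactSpace X]
    [MeasurableSpace X] [BorelSpace X]
    (p : ℝ≥0∞) (hp : 1 ≤ p) (ε : ℝ) (hε0 : 0 ≤ ε) (hε1 : ε < 1)
    (n : ℕ) (hn : 0 < n) (S T : Finset X) (hS : S.card = n) (hT : T.card = n)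
    (μ ν : Measure X)
    (hμ : μ = (n : ℝ≥0∞)⁻¹ • ∑ x ∈ S, Measure.dirac x)
    (hν : ν = (n : ℝ≥0∞)⁻¹ • ∑ y ∈ T, Measure.dirac y) :
    ∃ μ' ν' : Measure X,
      μ' ≤ μ ∧ ν' ≤ ν ∧
      (μ - μ') Set.univ ≤ ENNReal.ofReal ε ∧ (ν - ν') Set.univ ≤ ENNReal.ofReal ε ∧
      Wp p ((μ' Set.univ)⁻¹ • μ') ((ν' Set.univ)⁻¹ • ν') = RWp p ε μ ν ∧
      (∃ A : Finset X, A ⊆ S ∧ A.card = ⌊(1 - ε) * n⌋₊ ∧ ∃ x₀ ∈ S,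
        μ' = (n : ℝ≥0∞)⁻¹ • ∑ x ∈ A, Measure.dirac x +
          ENNReal.ofReal ((⌈ε * n⌉₊ : ℝ) / n - ε) • Measure.dirac x₀) ∧
      (∃ B : Finset X, B ⊆ T ∧ B.card = ⌊(1 - ε) * n⌋₊ ∧ ∃ y₀ ∈ T,
        ν' = (n : ℝ≥0∞)⁻¹ • ∑ y ∈ B, Measure.dirac y +
          ENNReal.ofReal ((⌈ε * n⌉₊ : ℝ) / n - ε) • Measure.dirac y₀) := by
  rw [unif_eq S n hn] at hμ
  rw [unif_eq T n hn] at hν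
  subst hμ hν
  have hn' : (0:ℝ) < n := by exact_mod_cast hn
  have hε : 0 < 1 - ε := by linarith
  have hspos : 0 < (1 - ε) * n := by positivity
  let G : Set (Measure X × Measure X) := {q |
    (q.1 ≤ discM S n (fun _ => 1) ∧
      (discM S n (fun _ => 1) - q.1) Set.univ ≤ ENNReal.ofReal ε ∧ goodShape S n ε q.1) ∧
    (q.2 ≤ discM T n (fun _ => 1) ∧
      (discM T n (fun _ => 1) - q.2) Set.univ ≤ ENNReal.ofReal ε ∧ goodShape T n ε q.2)}
  have hGfin : G.Finite := ((goodShape_finite S n ε).prod (goodShape_finite T n ε)).subset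
    fun q hq => ⟨hq.1.2.2, hq.2.2.2⟩
  have step : ∀ P ∈ polyK S T ((1 - ε) * n), ∃ q ∈ G,
      Wp p ((q.1 Set.univ)⁻¹ • q.1) ((q.2 Set.univ)⁻¹ • q.2) ≤
        eLpNorm (fun z : X × X => dist z.1 z.2) p (discP S T ((1 - ε) * n) P) := by
    intro P hP
    obtain ⟨c, hc⟩ := cost_mono S T _ hspos p hp P hP.1
    obtain ⟨Q, hQ, hcost, hu1, hu2⟩ := aux_comb _ P c hP
    refine ⟨(discM S n (fun i => ∑ j, Q i j), discM T n (fun j => ∑ i, Q i j)), ⟨?_, ?_⟩, ?_⟩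
    · exact good_of_rows S n hn hS ε hε0 hε1 _
        (fun i => Finset.sum_nonneg fun j _ => hQ.1 i j) hQ.2.1 hQ.2.2.2 hu1
    · exact good_of_rows T n hn hT ε hε0 hε1 _
        (fun j => Finset.sum_nonneg fun i _ => hQ.1 i j) hQ.2.2.1
        (by rw [Finset.sum_comm]; exact hQ.2.2.2) hu2
    · exact (iInf₂_le _ (discP_coupling S T n hn ε hε1 Q hQ)).trans (hc Q hQ.1 hcost)
  have hGne : G.Nonempty := by
    obtain ⟨q, hq, _⟩ := step (fun _ _ => (1 - ε) / n) (by
      refine ⟨fun _ _ => by positivity, fun _ => ?_, fun _ => ?_, ?_⟩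
      · simp [hT]; field_simp; linarith
      · simp [hS]; field_simp; linarith
      · simp [hS, hT]; field_simp)
    exact ⟨q, hq⟩
  obtain ⟨q, hq, hmin⟩ := Set.exists_min_image G
    (fun q => Wp p ((q.1 Set.univ)⁻¹ • q.1) ((q.2 Set.univ)⁻¹ • q.2)) hGfin hGne
  refine ⟨q.1, q.2, hq.1.1, hq.2.1, hq.1.2.1, hq.2.2.1, le_antisymm ?_ ?_, hq.1.2.2, hq.2.2.2⟩
  · refine le_iInf fun μ' => le_iInf fun ν' => le_iInf fun h1 => le_iInf fun h2 =>
      le_iInf fun h3 => le_iInf fun h4 => le_iInf₂ fun π hπ => ?_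
    obtain ⟨hπ1, hπ2⟩ := hπ
    obtain ⟨a1, a2, a3⟩ := marg S n hn hS ε hε0 hε1 μ' h1 h3
    obtain ⟨b1, _, b3⟩ := marg T n hn hT ε hε0 hε1 ν' h2 h4
    obtain ⟨P, hP, rfl⟩ := plan_disc S T n hn ε hε1 π
      (by rw [← hπ1, Measure.map_apply measurable_fst S.measurableSet.compl] at a1; exact a1)
      (by rw [← hπ2, Measure.map_apply measurable_snd T.measurableSet.compl] at b1; exact b1)
      (by rw [← hπ1, Measure.map_apply measurable_fst MeasurableSet.univ] at a2; exact a2)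
      (fun x hx => by
        have := a3 x hx
        rwa [← hπ1, Measure.map_apply measurable_fst (measurableSet_singleton x)] at this)
      (fun x hx => by
        have := b3 x hx
        rwa [← hπ2, Measure.map_apply measurable_snd (measurableSet_singleton x)] at this)
    obtain ⟨q', hq', hle⟩ := step P hP
    exact (hmin q' hq').trans hle
  · exact iInf_le_of_le q.1 <| iInf_le_of_le q.2 <| iInf_le_of_le hq.1.1 <|
      iInf_le_of_le hq.2.1 <| iInf_le_of_le hq.1.2.1 <| iInf_le_of_le hq.2.2.1 le_rfl

end
end

section
/- (One-sample rates.) Let X ⊂ ℝ^d be compact with d > 2, fix p ∈ [1,∞], ε ∈ [0,1/2], and τ ∈ (ε, 1], and let μ be a probability measure on X with empirical measure μ̂_n = (1/n)Σ_{i=1}^n δ_{X_i} for i.i.d. X_1,…,X_n ~ μ. If p < d/2, then E[W_p^ε(μ, μ̂_n)] ≤ C·n^{−1/d} for a constant C independent of n and ε. Furthermore, if the lower τ-covering dimension of μ satisfies d_*^τ(μ) > s, then for all sufficiently large n, W_p^ε(μ, γ) ≥ C'·(τ − ε)^{1/p}·n^{−1/s} for any probability measure γ supported on at most n points (including μ̂_n),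 where C' > 0 is an absolute constant. -/
open MeasureTheory ENNReal Filter Topology

noncomputable section

variable {X : Type*} [MetricSpace X] [MeasurableSpace X] [BorelSpace X]

/-- The `(δ,τ)`-covering number of `K` w.r.t. `γ`: the minimal number of closed balls of
radius `δ` covering `K` up to a set of `γ`-measure at most `τ`. -/
def coverNum {E : Type*} [MetricSpace E] [MeasurableSpace E]
    (K : Set E) (δ τ : ℝ) (γ : Measure E) : ℝ≥0∞ :=
  ⨅ (F : Finset E) (_ : γ (K \ ⋃ x ∈ F, Metric.closedBall x δ) ≤ ENNReal.ofReal τ),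
    (F.card : ℝ≥0∞)

/-- The lower `τ`-covering dimension `d_*^τ(γ) = liminf_{δ→0} log N_δ(γ,τ) / (−log δ)`. -/
def lowerDim {E : Type*} [MetricSpace E] [MeasurableSpace E]
    (K : Set E) (τ : ℝ) (γ : Measure E) : ℝ :=
  Filter.liminf (fun δ : ℝ => Real.log (coverNum K δ τ γ).toReal / (-Real.log δ))
    (𝓝[>] (0 : ℝ))

/-- The empirical measure of the samples `ω 0, …, ω (n-1)`. -/
def empMeas {E : Type*} [MeasurableSpace E] (n : ℕ) (ω : Fin n → E) : Measure E :=
  (n : ℝ≥0∞)⁻¹ • ∑ i, Measure.dirac (ω i)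

theorem cell_aux {E : Type*} [MeasurableSpace E] (α β : Measure E) [IsFiniteMeasure α]
    [IsFiniteMeasure β] (h : α Set.univ ≤ β Set.univ) :
    ∃ (π : Measure (E × E)) (α' β' : Measure E),
      π.map Prod.fst + α' = α ∧ π.map Prod.snd + β' = β ∧
      α' Set.univ = α Set.univ - β Set.univ ∧ β' Set.univ = β Set.univ - α Set.univ := by
  by_cases hb : β Set.univ = 0
  · have ha : α Set.univ = 0 := by simpa [hb] using h
    rw [Measure.measure_univ_eq_zero] at ha hb
    exact ⟨0, 0, 0, by simp [ha], by simp [hb], by simp [ha], by simp [hb]⟩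
  have hbt : β Set.univ ≠ ⊤ := measure_ne_top _ _
  have hle : (β Set.univ)⁻¹ * α Set.univ ≤ 1 := by
    rw [← ENNReal.inv_mul_cancel hb hbt]; gcongr
  refine ⟨(β Set.univ)⁻¹ • (α.prod β), 0, (1 - (β Set.univ)⁻¹ * α Set.univ) • β, ?_, ?_, ?_, ?_⟩
  · rw [Measure.map_smul, Measure.map_fst_prod, smul_smul, ENNReal.inv_mul_cancel hb hbt]; simp
  · rw [Measure.map_smul, Measure.map_snd_prod, smul_smul, ← add_smul, add_tsub_cancel_of_le hle,
      one_smul]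
  · simp [tsub_eq_zero_of_le h]
  · rw [Measure.smul_apply, smul_eq_mul, ENNReal.sub_mul (fun _ _ => hbt), one_mul, mul_right_comm,
      ENNReal.inv_mul_cancel hb hbt, one_mul]

theorem cell_lem {E : Type*} [MeasurableSpace E] (α β : Measure E) [IsFiniteMeasure α]
    [IsFiniteMeasure β] :
    ∃ (π : Measure (E × E)) (α' β' : Measure E),
      π.map Prod.fst + α' = α ∧ π.map Prod.snd + β' = β ∧
      α' Set.univ = α Set.univ - β Set.univ ∧ β' Set.univ = β Set.univ - α Set.univ := by
  rcases le_total (α Set.univ) (β Set.univ) with h | h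
  · exact cell_aux α β h
  · obtain ⟨π, β', α', h1, h2, h3, h4⟩ := cell_aux β α h
    refine ⟨π.map Prod.swap, α', β', ?_, ?_, h4, h3⟩
    · rw [Measure.map_map measurable_fst measurable_swap]; exact h2
    · rw [Measure.map_map measurable_snd measurable_swap]; exact h1

theorem step_lem {E ι : Type*} [MeasurableSpace E] [MeasurableSpace ι] [MeasurableSingletonClass ι]
    (f : E → ι) (hf : Measurable f) (S : Finset ι) (hS : ∀ x, f x ∈ S)
    (α β : Measure E) [IsFiniteMeasure α] [IsFiniteMeasure β] :
    ∃ (π : Measure (E × E)) (α' β' : Measure E),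
      π.map Prod.fst + α' = α ∧ π.map Prod.snd + β' = β ∧
      α' Set.univ = ∑ i ∈ S, (α (f ⁻¹' {i}) - β (f ⁻¹' {i})) ∧
      β' Set.univ = ∑ i ∈ S, (β (f ⁻¹' {i}) - α (f ⁻¹' {i})) ∧
      (∀ᵐ z ∂π, f z.1 = f z.2) := by
  have hm : ∀ i, MeasurableSet (f ⁻¹' {i}) := fun i => hf (measurableSet_singleton i)
  have hdec : ∀ ρ : Measure E, ∑ i ∈ S, ρ.restrict (f ⁻¹' {i}) = ρ := by
    intro ρ
    have hU : (⋃ i ∈ S, f ⁻¹' {i}) = Set.univ := by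
      ext x; simp [hS]
    ext s hs
    rw [Measure.finsetSum_apply]
    simp_rw [Measure.restrict_apply hs]
    rw [← measure_biUnion_finset]
    · rw [← Set.inter_iUnion₂, hU, Set.inter_univ]
    · intro i _ j _ hij
      refine Disjoint.mono Set.inter_subset_right Set.inter_subset_right ?_
      rw [Set.disjoint_left]; intro x hx hx'
      exact hij (by rw [← (hx : f x = i), ← (hx' : f x = j)])
    · intro i _; exact hs.inter (hm i)
  choose π α' β' h1 h2 h3 h4 using
    fun i => cell_lem (α.restrict (f ⁻¹' {i})) (β.restrict (f ⁻¹' {i}))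
  have hmap : ∀ (g : E × E → E), Measurable g →
      (∑ i ∈ S, π i).map g = ∑ i ∈ S, (π i).map g := by
    intro g hg
    ext s hs
    rw [Measure.map_apply hg hs]
    simp [Measure.finsetSum_apply, Measure.map_apply hg hs]
  refine ⟨∑ i ∈ S, π i, ∑ i ∈ S, α' i, ∑ i ∈ S, β' i, ?_, ?_, ?_, ?_, ?_⟩
  · rw [hmap _ measurable_fst, ← Finset.sum_add_distrib]
    simp_rw [h1]; exact hdec α
  · rw [hmap _ measurable_snd, ← Finset.sum_add_distrib]
    simp_rw [h2]; exact hdec β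
  · simp [Measure.finsetSum_apply, h3]
  · simp [Measure.finsetSum_apply, h4]
  · have key : ∀ i, ∀ᵐ z ∂(π i), f z.1 = f z.2 := by
      intro i
      have e1 : ∀ᵐ x ∂((π i).map Prod.fst), f x = i := by
        have : (π i).map Prod.fst ≤ α.restrict (f ⁻¹' {i}) := by
          rw [← h1 i]; exact Measure.le_add_right le_rfl
        exact Measure.absolutelyContinuous_of_le this |>.ae_le (ae_restrict_mem (hm i))
      have e2 : ∀ᵐ x ∂((π i).map Prod.snd), f x = i := by
        have : (π i).map Prod.snd ≤ β.restrict (f ⁻¹' {i}) := by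
          rw [← h2 i]; exact Measure.le_add_right le_rfl
        exact Measure.absolutelyContinuous_of_le this |>.ae_le (ae_restrict_mem (hm i))
      filter_upwards [ae_of_ae_map measurable_fst.aemeasurable e1,
        ae_of_ae_map measurable_snd.aemeasurable e2] with z a b
      rw [a, b]
    rw [ae_iff, Measure.finsetSum_apply]
    exact Finset.sum_eq_zero fun i _ => by have := key i; rwa [ae_iff] at this

theorem transport_lem {E ι : Type*} [MeasurableSpace E] [MeasurableSpace ι]
    [MeasurableSingletonClass ι]
    (f : ℕ → E → ι) (hf : ∀ k, Measurable (f k)) (S : ℕ → Finset ι) (hS : ∀ k x, f k x ∈ S k)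
    (h0 : ∀ x y, f 0 x = f 0 y) (hn : ∀ k x y, f (k + 1) x = f (k + 1) y → f k x = f k y)
    (c : E × E → ℝ≥0∞) (D : ℕ → ℝ≥0∞) (hc : ∀ k x y, f k x = f k y → c (x, y) ≤ D k)
    (m : ℕ) : ∀ (α β : Measure E) [IsFiniteMeasure α] [IsFiniteMeasure β],
      α Set.univ = β Set.univ →
      ∃ π : Measure (E × E), π.map Prod.fst = α ∧ π.map Prod.snd = β ∧
        ∫⁻ z, c z ∂π ≤ D m * α Set.univ + ∑ k ∈ Finset.range m,
          D k * ∑ i ∈ S (k + 1), (α (f (k + 1) ⁻¹' {i}) - β (f (k + 1) ⁻¹' {i})) := by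
  have hnest : ∀ j k, j ≤ k → ∀ x y, f k x = f k y → f j x = f j y := by
    intro j k hjk
    induction k, hjk using Nat.le_induction with
    | base => exact fun _ _ h => h
    | succ k _ ih => exact fun x y h => ih x y (hn k x y h)
  induction m with
  | zero =>
    intro α β _ _ hab
    obtain ⟨π, α', β', h1, h2, h3, h4⟩ := cell_lem α β
    rw [hab, tsub_self, Measure.measure_univ_eq_zero] at h3
    rw [hab, tsub_self, Measure.measure_univ_eq_zero] at h4
    subst h3 h4
    rw [add_zero] at h1 h2
    refine ⟨π, h1, h2, ?_⟩
    calc ∫⁻ z, c z ∂π ≤ ∫⁻ z, D 0 ∂π := lintegral_mono fun z => hc 0 _ _ (h0 _ _)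
      _ = D 0 * α Set.univ := by
        rw [lintegral_const, ← h1, Measure.map_apply measurable_fst MeasurableSet.univ]; simp
      _ ≤ _ := by simp
  | succ m ih =>
    intro α β _ _ hab
    obtain ⟨π, α', β', h1, h2, h3, h4, h5⟩ := step_lem (f (m + 1)) (hf _) (S (m + 1)) (hS _) α β
    have hα' : α' ≤ α := by rw [← h1]; exact Measure.le_add_left le_rfl
    have hβ' : β' ≤ β := by rw [← h2]; exact Measure.le_add_left le_rfl
    have : IsFiniteMeasure α' := isFiniteMeasure_of_le α hα'
    have : IsFiniteMeasure β' := isFiniteMeasure_of_le β hβ'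
    have hπu : π Set.univ ≤ α Set.univ := by
      rw [← h1, Measure.add_apply, Measure.map_apply measurable_fst MeasurableSet.univ]; simp
    have hπf : π Set.univ ≠ ⊤ := (hπu.trans_lt (measure_lt_top α _)).ne
    have : IsFiniteMeasure π := ⟨hπf.lt_top⟩
    have hab' : α' Set.univ = β' Set.univ := by
      have e1 : π Set.univ + α' Set.univ = α Set.univ := by
        conv_rhs => rw [← h1]
        rw [Measure.add_apply, Measure.map_apply measurable_fst MeasurableSet.univ]; simp
      have e2 : π Set.univ + β' Set.univ = β Set.univ := by
        conv_rhs => rw [← h2]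
        rw [Measure.add_apply, Measure.map_apply measurable_snd MeasurableSet.univ]; simp
      rw [← e1, ← e2] at hab
      exact (ENNReal.add_right_inj hπf).1 hab
    obtain ⟨π', g1, g2, g3⟩ := ih α' β' hab'
    refine ⟨π + π', ?_, ?_, ?_⟩
    · rw [Measure.map_add _ _ measurable_fst, g1, h1]
    · rw [Measure.map_add _ _ measurable_snd, g2, h2]
    · rw [lintegral_add_measure, Finset.sum_range_succ]
      have c1 : ∫⁻ z, c z ∂π ≤ D (m + 1) * α Set.univ := by
        calc ∫⁻ z, c z ∂π ≤ ∫⁻ z, D (m + 1) ∂π := by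
              apply lintegral_mono_ae
              filter_upwards [h5] with z hz
              exact hc _ _ _ hz
          _ = D (m + 1) * π Set.univ := lintegral_const _
          _ ≤ _ := by gcongr
      have c2 : ∑ k ∈ Finset.range m,
          D k * ∑ i ∈ S (k + 1), (α' (f (k + 1) ⁻¹' {i}) - β' (f (k + 1) ⁻¹' {i})) ≤
          ∑ k ∈ Finset.range m,
          D k * ∑ i ∈ S (k + 1), (α (f (k + 1) ⁻¹' {i}) - β (f (k + 1) ⁻¹' {i})) := by
        refine Finset.sum_le_sum fun k hk => ?_
        refine mul_le_mul' le_rfl (Finset.sum_le_sum fun i hi => ?_)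
        have hQ : MeasurableSet (f (k + 1) ⁻¹' {i}) := hf _ (measurableSet_singleton i)
        have e : π (Prod.fst ⁻¹' (f (k + 1) ⁻¹' {i})) = π (Prod.snd ⁻¹' (f (k + 1) ⁻¹' {i})) := by
          apply measure_congr
          filter_upwards [h5] with z hz
          have := hnest (k + 1) (m + 1) (by have := Finset.mem_range.1 hk; omega) _ _ hz
          apply propext
          change f (k + 1) z.1 = i ↔ f (k + 1) z.2 = i
          rw [this]
        conv_rhs => rw [← h1, ← h2]
        rw [Measure.add_apply, Measure.add_apply, Measure.map_apply measurable_fst hQ,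
          Measure.map_apply measurable_snd hQ, e, ENNReal.add_sub_add_eq_sub_left (measure_ne_top _ _)]
      rw [← h3]
      calc _ ≤ D (m + 1) * α Set.univ + (D m * α' Set.univ + _) := add_le_add c1 (g3.trans (add_le_add le_rfl c2))
        _ = _ := by ring

theorem lower_aux {E : Type*} [MetricSpace E] [MeasurableSpace E] [BorelSpace E]
    [SecondCountableTopology E]
    (p : ℝ≥0∞) (hp : 1 ≤ p) (K : Set E) (μ γ : Measure E) [IsProbabilityMeasure μ]
    [IsProbabilityMeasure γ] (F : Finset E) (hF : γ (↑F : Set E)ᶜ = 0) (ε τ δ : ℝ)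
    (hε : 0 ≤ ε) (hετ : ε < τ) (hδ : 0 < δ)
    (hK : ENNReal.ofReal τ < μ (K \ ⋃ x ∈ F, Metric.closedBall x δ)) :
    ENNReal.ofReal ((τ - ε) ^ (1 / p.toReal) * δ) ≤ RWp p ε μ γ := by
  unfold RWp Wp
  refine le_iInf fun μ' => le_iInf fun ν' => le_iInf fun hμ' => le_iInf fun hν' => le_iInf fun h1 =>
    le_iInf fun h2 => le_iInf fun π => le_iInf fun hπ => ?_
  obtain ⟨hπ1, hπ2⟩ := hπ
  have : IsFiniteMeasure μ' := isFiniteMeasure_of_le μ hμ'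
  set A : Set E := (⋃ x ∈ F, Metric.closedBall x δ)ᶜ with hA
  have hAm : MeasurableSet A := by
    refine MeasurableSet.compl ?_
    exact Finset.measurableSet_biUnion _ fun x _ => Metric.isClosed_closedBall.measurableSet
  have hμA : ENNReal.ofReal τ < μ A := hK.trans_le (measure_mono fun x hx => hx.2)
  have h3 : ENNReal.ofReal (τ - ε) ≤ μ' A := by
    have : μ A - μ' A ≤ ENNReal.ofReal ε := by
      rw [← Measure.sub_apply hAm hμ']
      exact (measure_mono (Set.subset_univ _)).trans h1
    rw [ENNReal.ofReal_sub _ hε]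
    rw [tsub_le_iff_right] at this ⊢
    rw [add_comm]
    exact hμA.le.trans this
  have hu : μ' Set.univ ≤ 1 := by simpa using hμ' Set.univ
  have h4 : ENNReal.ofReal (τ - ε) ≤ π (Prod.fst ⁻¹' A) := by
    rw [← Measure.map_apply measurable_fst hAm, hπ1, Measure.smul_apply, smul_eq_mul]
    calc ENNReal.ofReal (τ - ε) ≤ 1 * μ' A := by simpa using h3
      _ ≤ _ := by gcongr; exact ENNReal.one_le_inv.2 hu
  have h5 : ∀ᵐ z ∂π, z.2 ∈ (F : Set E) := by
    have hFm : MeasurableSet (F : Set E) := F.measurableSet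
    have : ∀ᵐ y ∂(π.map Prod.snd), y ∈ (F : Set E) := by
      rw [hπ2]
      have h0 : ν' (F : Set E)ᶜ = 0 := le_antisymm ((hν' _).trans hF.le) bot_le
      rw [ae_iff, Measure.smul_apply]
      change _ • ν' (F : Set E)ᶜ = 0
      rw [h0, smul_zero]
    exact ae_of_ae_map measurable_snd.aemeasurable this
  set B : Set (E × E) := {z | ENNReal.ofReal δ ≤ ‖dist z.1 z.2‖ₑ} with hB
  have h6 : ENNReal.ofReal (τ - ε) ≤ π B := by
    refine h4.trans (measure_mono_ae ?_)
    filter_upwards [h5] with z hz hzA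
    have hzA' : z.1 ∈ A := hzA
    rw [hA, Set.mem_compl_iff, Set.mem_iUnion₂] at hzA'
    push Not at hzA'
    have := hzA' z.2 (by simpa using hz)
    rw [Metric.mem_closedBall, not_le] at this
    change ENNReal.ofReal δ ≤ ‖dist z.1 z.2‖ₑ
    rw [Real.enorm_eq_ofReal dist_nonneg]
    exact ENNReal.ofReal_le_ofReal this.le
  have hpos : 0 < ENNReal.ofReal (τ - ε) := ENNReal.ofReal_pos.2 (by linarith)
  by_cases hpt : p = ⊤
  · subst hpt
    have e : (τ - ε) ^ (1 / (⊤ : ℝ≥0∞).toReal) * δ = δ := by simp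
    rw [e, eLpNorm_exponent_top]
    by_contra hcon
    push Not at hcon
    have h7 := ae_lt_of_essSup_lt hcon
    have h8 : π B = 0 := by
      rw [ae_iff] at h7
      simpa only [not_lt] using h7
    rw [h8] at h6
    exact absurd h6 (not_le.2 hpos)
  · have hp0 : p ≠ 0 := (zero_lt_one.trans_le hp).ne'
    have hpp : 0 < p.toReal := ENNReal.toReal_pos hp0 hpt
    have hmeas : AEStronglyMeasurable (fun z : E × E => dist z.1 z.2) π :=
      (continuous_dist.measurable).aestronglyMeasurable
    have := mul_meas_ge_le_pow_eLpNorm' π hp0 hpt hmeas (ENNReal.ofReal δ)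
    rw [← ENNReal.rpow_le_rpow_iff hpp]
    refine le_trans ?_ this
    rw [ENNReal.ofReal_rpow_of_nonneg (by have := Real.rpow_nonneg (sub_nonneg.2 hετ.le) (1 / p.toReal); positivity) hpp.le,
      Real.mul_rpow (Real.rpow_nonneg (sub_nonneg.2 hετ.le) _) hδ.le,
      ← Real.rpow_mul (sub_nonneg.2 hετ.le), one_div_mul_cancel hpp.ne', Real.rpow_one, mul_comm,
      ENNReal.ofReal_mul (by positivity), ENNReal.ofReal_rpow_of_nonneg hδ.le hpp.le]
    gcongr

theorem lower_lem {E : Type*} [MetricSpace E] [MeasurableSpace E] [BorelSpace E]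
    [SecondCountableTopology E]
    (p : ℝ≥0∞) (hp : 1 ≤ p) (K : Set E) (μ : Measure E) [IsProbabilityMeasure μ]
    (ε τ s : ℝ) (hε : 0 ≤ ε) (hετ : ε < τ) (hs : 0 < s) (hsd : s < lowerDim K τ μ) :
    ∃ N : ℕ, ∀ n : ℕ, N ≤ n → ∀ γ : Measure E, IsProbabilityMeasure γ →
      (∃ F : Finset E, F.card ≤ n ∧ γ (↑F : Set _)ᶜ = 0) →
      ENNReal.ofReal (1 * (τ - ε) ^ (1 / p.toReal) * (n : ℝ) ^ (-(1 / s))) ≤ RWp p ε μ γ := by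
  unfold lowerDim at hsd
  rw [Filter.liminf_eq] at hsd
  have hne : {a : ℝ | ∀ᶠ δ in 𝓝[>] (0 : ℝ),
      a ≤ Real.log (coverNum K δ τ μ).toReal / (-Real.log δ)}.Nonempty := by
    by_contra hcon
    rw [Set.not_nonempty_iff_eq_empty] at hcon
    rw [hcon, Real.sSup_empty] at hsd
    linarith
  obtain ⟨a, ha, hsa⟩ := exists_lt_of_lt_csSup hne hsd
  have ht : Tendsto (fun n : ℕ => (n : ℝ) ^ (-(1 / s))) atTop (𝓝[>] (0 : ℝ)) := by
    rw [tendsto_nhdsWithin_iff]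
    refine ⟨(tendsto_rpow_neg_atTop (by positivity)).comp tendsto_natCast_atTop_atTop, ?_⟩
    filter_upwards [eventually_gt_atTop 0] with n hn
    have : (0 : ℝ) < n := by exact_mod_cast hn
    exact Real.rpow_pos_of_pos this _
  have hev := (ht.eventually ha).and (eventually_gt_atTop 1)
  obtain ⟨N, hN⟩ := eventually_atTop.1 hev
  refine ⟨N, fun n hn γ hγ ⟨F, hFn, hF⟩ => ?_⟩
  obtain ⟨h1, h2⟩ := hN n hn
  have hn1 : (1 : ℝ) < n := by exact_mod_cast h2
  have hn0 : (0 : ℝ) < n := by linarith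
  have hδ : (0 : ℝ) < (n : ℝ) ^ (-(1 / s)) := Real.rpow_pos_of_pos hn0 _
  rw [one_mul]
  refine lower_aux p hp K μ γ F hF ε τ _ hε hετ hδ ?_
  by_contra hcon
  push Not at hcon
  have hcov : coverNum K ((n : ℝ) ^ (-(1 / s))) τ μ ≤ n := by
    unfold coverNum
    refine (iInf₂_le F hcon).trans ?_
    exact_mod_cast hFn
  have hlogn : 0 < Real.log n := Real.log_pos hn1
  rw [Real.log_rpow hn0, neg_mul, neg_neg, le_div_iff₀ (by positivity)] at h1
  have h3 : Real.log (coverNum K ((n : ℝ) ^ (-(1 / s))) τ μ).toReal ≤ Real.log n := by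
    have hle : (coverNum K ((n : ℝ) ^ (-(1 / s))) τ μ).toReal ≤ n := by
      have := ENNReal.toReal_mono (by simp) hcov
      simpa using this
    rcases (ENNReal.toReal_nonneg (a := coverNum K ((n : ℝ) ^ (-(1 / s))) τ μ)).eq_or_lt with h | h
    · rw [← h]; simpa using hlogn.le
    · exact Real.log_le_log h hle
  have h4 : a * (1 / s * Real.log n) = (a / s) * Real.log n := by ring
  have h5 : 1 < a / s := by rw [lt_div_iff₀ hs]; linarith
  nlinarith

theorem grid_lem (d : ℕ) (K : Set (EuclideanSpace ℝ (Fin d))) (hK : IsCompact K) :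
    ∃ (L : ℝ) (f : ℕ → EuclideanSpace ℝ (Fin d) → (Fin d → ℕ)), 0 ≤ L ∧
      (∀ k, Measurable (f k)) ∧
      (∀ k x, f k x ∈ Fintype.piFinset fun _ : Fin d => Finset.range (2 ^ k)) ∧
      (∀ x y, f 0 x = f 0 y) ∧ (∀ k x y, f (k + 1) x = f (k + 1) y → f k x = f k y) ∧
      (∀ k, ∀ x ∈ K, ∀ y ∈ K, f k x = f k y → dist x y ≤ L / 2 ^ k) := by
  obtain ⟨R, hR0, hR⟩ : ∃ R : ℝ, 0 ≤ R ∧ ∀ x ∈ K, ‖x‖ ≤ R := by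
    obtain ⟨R, hR⟩ := hK.isBounded.exists_norm_le
    exact ⟨max R 0, le_max_right _ _, fun x hx => (hR x hx).trans (le_max_left _ _)⟩
  set W : ℝ := 2 * R + 1 with hW
  have hWp : 0 < W := by positivity
  have hcoord : ∀ (x : EuclideanSpace ℝ (Fin d)) i, |x i| ≤ ‖x‖ := fun x i => by
    simpa using PiLp.norm_apply_le x i
  refine ⟨d * W, fun k x i => min ⌊2 ^ k * ((x i + R) / W)⌋₊ (2 ^ k - 1), by positivity,
    ?_, ?_, ?_, ?_, ?_⟩
  · intro k
    refine measurable_pi_lambda _ fun i => ?_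
    refine Measurable.min (Nat.measurable_floor.comp ?_) measurable_const
    fun_prop
  · intro k x
    rw [Fintype.mem_piFinset]
    intro i
    rw [Finset.mem_range]
    have : 0 < 2 ^ k := by positivity
    change min ⌊2 ^ k * ((x i + R) / W)⌋₊ (2 ^ k - 1) < 2 ^ k
    omega
  · intro x y
    funext i
    simp
  · intro k x y h
    have key : ∀ x : EuclideanSpace ℝ (Fin d), ∀ i, min ⌊2 ^ k * ((x i + R) / W)⌋₊ (2 ^ k - 1) =
        min ⌊2 ^ (k + 1) * ((x i + R) / W)⌋₊ (2 ^ (k + 1) - 1) / 2 := by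
      intro x i
      have e : ⌊2 ^ k * ((x i + R) / W)⌋₊ = ⌊2 ^ (k + 1) * ((x i + R) / W)⌋₊ / 2 := by
        rw [← Nat.floor_div_ofNat]
        congr 1
        rw [pow_succ]; ring
      rw [e, pow_succ]
      have : 0 < 2 ^ k := by positivity
      omega
    funext i
    have hi := congrFun h i
    simp only at hi ⊢
    rw [key, key, hi]
  · intro k x hx y hy h
    have hbd : ∀ x ∈ K, ∀ i, 0 ≤ (x i + R) / W ∧ (x i + R) / W < 1 := by
      intro x hx i
      have h1 := (hcoord x i).trans (hR x hx)
      rw [abs_le] at h1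
      constructor
      · apply div_nonneg _ hWp.le; linarith
      · rw [div_lt_one hWp]; linarith
    have hmin : ∀ x ∈ K, ∀ i, min ⌊2 ^ k * ((x i + R) / W)⌋₊ (2 ^ k - 1) =
        ⌊2 ^ k * ((x i + R) / W)⌋₊ := by
      intro x hx i
      obtain ⟨h1, h2⟩ := hbd x hx i
      have : ⌊2 ^ k * ((x i + R) / W)⌋₊ < 2 ^ k := by
        rw [Nat.floor_lt (by positivity)]
        push_cast
        have : (0 : ℝ) < 2 ^ k := by positivity
        nlinarith
      omega
    have hco : ∀ i, |x i - y i| ≤ W / 2 ^ k := by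
      intro i
      have hi := congrFun h i
      simp only at hi
      rw [hmin x hx, hmin y hy] at hi
      have a1 := Nat.floor_le (a := 2 ^ k * ((x i + R) / W))
        (by have := (hbd x hx i).1; positivity)
      have a2 := Nat.lt_floor_add_one (2 ^ k * ((x i + R) / W))
      have b1 := Nat.floor_le (a := 2 ^ k * ((y i + R) / W))
        (by have := (hbd y hy i).1; positivity)
      have b2 := Nat.lt_floor_add_one (2 ^ k * ((y i + R) / W))
      rw [hi] at a1 a2
      have hp : (0 : ℝ) < 2 ^ k := by positivity
      have hd : 2 ^ k * ((x i + R) / W) - 2 ^ k * ((y i + R) / W) = 2 ^ k * (x i - y i) / W := by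
        ring
      have : |2 ^ k * (x i - y i) / W| ≤ 1 := by
        rw [← hd, abs_le]; constructor <;> linarith
      rw [abs_div, abs_mul, abs_of_pos hp, abs_of_pos hWp, div_le_one hWp] at this
      rw [le_div_iff₀ hp]; linarith
    rw [EuclideanSpace.dist_eq]
    have hnn : 0 ≤ W / 2 ^ k := by positivity
    calc √(∑ i, dist (x i) (y i) ^ 2) ≤ √((d * W / 2 ^ k) ^ 2) := by
          apply Real.sqrt_le_sqrt
          calc ∑ i, dist (x i) (y i) ^ 2 ≤ ∑ i : Fin d, (W / 2 ^ k) ^ 2 := by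
                gcongr with i; rw [Real.dist_eq]; exact hco i
            _ = d * (W / 2 ^ k) ^ 2 := by simp
            _ ≤ (d : ℝ) ^ 2 * (W / 2 ^ k) ^ 2 := by
                gcongr
                rcases Nat.eq_zero_or_pos d with h | h
                · simp [h]
                · have : (1 : ℝ) ≤ d := by exact_mod_cast h
                  nlinarith
            _ = _ := by ring
      _ = _ := Real.sqrt_sq (by positivity)

theorem empMeas_apply' {E : Type*} [MeasurableSpace E] (n : ℕ) (ω : Fin n → E) (Q : Set E)
    (hQ : MeasurableSet Q) :
    (empMeas n ω).real Q = (n : ℝ)⁻¹ * ∑ i, Q.indicator (fun _ => (1 : ℝ)) (ω i) := by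
  unfold empMeas
  rw [measureReal_def, Measure.smul_apply, Measure.finsetSum_apply, smul_eq_mul, ENNReal.toReal_mul,
    ENNReal.toReal_sum]
  · congr 1
    · simp
    · refine Finset.sum_congr rfl fun i _ => ?_
      rw [Measure.dirac_apply' _ hQ]
      by_cases h : ω i ∈ Q <;> simp [h]
  · intro i _; exact measure_ne_top _ _

theorem empMeas_prob {E : Type*} [MeasurableSpace E] (n : ℕ) (hn : 0 < n) (ω : Fin n → E) :
    IsProbabilityMeasure (empMeas n ω) := by
  constructor
  unfold empMeas
  rw [Measure.smul_apply, Measure.finsetSum_apply]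
  simp only [measure_univ, Finset.sum_const, Finset.card_univ, Fintype.card_fin, smul_eq_mul,
    nsmul_eq_mul, mul_one]
  exact ENNReal.inv_mul_cancel (by simpa using hn.ne') (by simp)

theorem dev_lem {E : Type*} [MeasurableSpace E] (μ : Measure E) [IsProbabilityMeasure μ]
    (n : ℕ) (hn : 0 < n) (Q : Set E) (hQ : MeasurableSet Q) :
    Integrable (fun ω => |μ.real Q - (empMeas n ω).real Q|) (Measure.pi fun _ : Fin n => μ) ∧
    ∫ ω, |μ.real Q - (empMeas n ω).real Q| ∂(Measure.pi fun _ : Fin n => μ) ≤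
      √(μ.real Q / n) := by
  have hn0 : (0 : ℝ) < n := by exact_mod_cast hn
  simp_rw [empMeas_apply' n _ Q hQ]
  set P : Measure (Fin n → E) := Measure.pi fun _ : Fin n => μ with hP
  set X : E → ℝ := Q.indicator (fun _ => (1 : ℝ)) with hX
  have hXm : Measurable X := measurable_const.indicator hQ
  have hXL : MemLp X 2 μ := memLp_indicator_const 2 hQ 1 (Or.inr (measure_ne_top _ _))
  have hXi : ∫ x, X x ∂μ = μ.real Q := by
    rw [hX, integral_indicator hQ]; simp
  have hpres : ∀ i : Fin n, MeasurePreserving (fun ω : Fin n → E => ω i) P μ :=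
    fun i => measurePreserving_eval (fun _ : Fin n => μ) i
  set Z : (Fin n → E) → ℝ := ∑ i, fun ω : Fin n → E => X (ω i) with hZ
  have hZL : MemLp Z 2 P := memLp_finsetSum' _ fun i _ => hXL.comp_measurePreserving (hpres i)
  have hZi : ∫ ω, Z ω ∂P = n * μ.real Q := by
    simp only [hZ, Finset.sum_apply]
    rw [integral_finsetSum]
    · have : ∀ i : Fin n, ∫ ω, X (ω i) ∂P = μ.real Q := by
        intro i
        rw [← hXi, ← (hpres i).map_eq, integral_map (hpres i).measurable.aemeasurable
          hXm.aestronglyMeasurable]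
      simp [this]
    · intro i _
      exact (hXL.comp_measurePreserving (hpres i)).integrable one_le_two
  have hVar : ProbabilityTheory.variance Z P ≤ n * μ.real Q := by
    rw [hZ, hP, ProbabilityTheory.variance_sum_pi (fun _ => hXL)]
    have : ProbabilityTheory.variance X μ ≤ μ.real Q := by
      refine (ProbabilityTheory.variance_le_expectation_sq hXm.aestronglyMeasurable).trans ?_
      rw [← hXi]
      apply le_of_eq
      congr 1
      funext x
      by_cases h : x ∈ Q <;> simp [hX, h]
    simp only [Finset.sum_const, Finset.card_univ, Fintype.card_fin, nsmul_eq_mul]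
    gcongr
  set Y : (Fin n → E) → ℝ := fun ω => |μ.real Q - (n : ℝ)⁻¹ * ∑ i, X (ω i)| with hY
  have hYL : MemLp Y 2 P := by
    have := ((memLp_const (μ.real Q)).sub (hZL.const_mul (n : ℝ)⁻¹)).abs
    convert this using 1
    funext ω
    simp [hY, hZ]
  refine ⟨hYL.integrable one_le_two, ?_⟩
  have h1 := ProbabilityTheory.variance_nonneg Y P
  rw [ProbabilityTheory.variance_eq_sub hYL] at h1
  apply Real.le_sqrt_of_sq_le
  have h2 : ∫ ω, (Y ^ 2) ω ∂P = ProbabilityTheory.variance Z P / n ^ 2 := by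
    rw [ProbabilityTheory.variance_eq_integral hZL.aestronglyMeasurable.aemeasurable, hZi,
      ← integral_div]
    congr 1
    funext ω
    simp only [Pi.pow_apply, hY, sq_abs, hZ, Finset.sum_apply]
    field_simp
    ring
  have h3 : ProbabilityTheory.variance Z P / n ^ 2 ≤ μ.real Q / n := by
    rw [div_le_div_iff₀ (by positivity) hn0]
    nlinarith
  linarith

theorem analytic_lem (d : ℕ) (hd : 2 < d) (q L : ℝ) (hq1 : 1 ≤ q) (hq : q < (d : ℝ) / 2)
    (hL : 0 ≤ L) : ∃ C0 : ℝ, 0 ≤ C0 ∧ ∀ n : ℕ, 0 < n → ∃ m : ℕ,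
      (L / 2 ^ m) ^ q + ∑ k ∈ Finset.range m, (L / 2 ^ k) ^ q * √(((2 : ℝ) ^ (k + 1)) ^ d / n) ≤
        C0 * ((n : ℝ) ^ (-(1 / (d : ℝ)))) ^ q := by
  set e : ℝ := (d : ℝ) / 2 - q with he
  have hepos : 0 < e := by rw [he]; linarith
  set r : ℝ := (2 : ℝ) ^ e with hr
  have hr1 : 1 < r := Real.one_lt_rpow one_lt_two hepos
  have hr1' : 0 < r - 1 := by linarith
  have hd0 : (d : ℝ) ≠ 0 := by positivity
  have hLq : 0 ≤ L ^ q := Real.rpow_nonneg hL _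
  refine ⟨L ^ q * 2 ^ q + L ^ q * 2 ^ ((d : ℝ) / 2) / (r - 1), by positivity, fun n hn => ?_⟩
  have hn0 : (0 : ℝ) < n := by exact_mod_cast hn
  have hn1 : (1 : ℝ) ≤ n := by exact_mod_cast hn
  set x : ℝ := (n : ℝ) ^ (1 / (d : ℝ)) with hx
  have hx0 : 0 < x := Real.rpow_pos_of_pos hn0 _
  have hx1 : 1 ≤ x := Real.one_le_rpow hn1 (by positivity)
  have hxd : x ^ (d : ℝ) = n := by
    rw [hx, ← Real.rpow_mul hn0.le, one_div_mul_cancel hd0, Real.rpow_one]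
  have ht : ((n : ℝ) ^ (-(1 / (d : ℝ)))) ^ q = x ^ (-q) := by
    rw [Real.rpow_neg hn0.le, ← hx, Real.rpow_neg hx0.le, Real.inv_rpow hx0.le]
  rw [ht]
  obtain ⟨m, hm1, hm2⟩ := exists_nat_pow_near hx1 one_lt_two
  refine ⟨m, ?_⟩
  have t1 : (L / 2 ^ m) ^ q ≤ L ^ q * 2 ^ q * x ^ (-q) := by
    have : L / 2 ^ m ≤ L * 2 * x⁻¹ := by
      rw [div_eq_mul_inv, mul_assoc]
      gcongr
      rw [← div_eq_mul_inv, inv_le_comm₀ (by positivity) (by positivity), inv_div]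
      rw [pow_succ] at hm2
      linarith
    calc (L / 2 ^ m) ^ q ≤ (L * 2 * x⁻¹) ^ q := by gcongr
      _ = _ := by
        rw [Real.mul_rpow (by positivity) (by positivity), Real.mul_rpow hL (by norm_num),
          Real.inv_rpow hx0.le, Real.rpow_neg hx0.le]
  have t2 : ∀ k : ℕ, (L / 2 ^ k) ^ q * √(((2 : ℝ) ^ (k + 1)) ^ d / n) =
      L ^ q * 2 ^ ((d : ℝ) / 2) * x ^ (-((d : ℝ) / 2)) * r ^ k := by
    intro k
    have h2 : (0 : ℝ) < 2 := two_pos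
    have e1 : √(((2 : ℝ) ^ (k + 1)) ^ d / n) =
        2 ^ (((k : ℝ) + 1) * ((d : ℝ) / 2)) * x ^ (-((d : ℝ) / 2)) := by
      rw [Real.sqrt_eq_rpow, Real.div_rpow (by positivity) hn0.le, ← hxd, ← Real.rpow_mul hx0.le,
        div_eq_mul_inv, ← Real.rpow_neg hx0.le, ← pow_mul, ← Real.rpow_natCast,
        ← Real.rpow_mul h2.le]
      congr 2
      · push_cast; ring
      · ring
    have e2 : (L / 2 ^ k) ^ q = L ^ q * 2 ^ (-((k : ℝ) * q)) := by
      rw [Real.div_rpow hL (by positivity), ← Real.rpow_natCast, ← Real.rpow_mul h2.le,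
        div_eq_mul_inv, ← Real.rpow_neg h2.le]
    have e3 : r ^ k = 2 ^ ((k : ℝ) * ((d : ℝ) / 2)) * 2 ^ (-((k : ℝ) * q)) := by
      rw [hr, ← Real.rpow_natCast, ← Real.rpow_mul h2.le, ← Real.rpow_add h2]
      congr 1
      rw [he]; ring
    have e4 : (2 : ℝ) ^ (((k : ℝ) + 1) * ((d : ℝ) / 2)) =
        2 ^ ((k : ℝ) * ((d : ℝ) / 2)) * 2 ^ ((d : ℝ) / 2) := by
      rw [← Real.rpow_add h2]; congr 1; ring
    rw [e1, e2, e3, e4]; ring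
  simp_rw [t2]
  rw [← Finset.mul_sum, add_mul]
  refine add_le_add t1 ?_
  have t3 : ∑ k ∈ Finset.range m, r ^ k ≤ x ^ e / (r - 1) := by
    rw [geom_sum_eq hr1.ne']
    gcongr
    have : r ^ m ≤ x ^ e := by
      rw [hr, ← Real.rpow_natCast, ← Real.rpow_mul (by norm_num), mul_comm, Real.rpow_mul (by norm_num),
        Real.rpow_natCast]
      gcongr
    linarith
  have t4 : x ^ (-q) = x ^ (-((d : ℝ) / 2)) * x ^ e := by
    rw [← Real.rpow_add hx0]; congr 1; rw [he]; ring
  rw [t4]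
  calc _ ≤ L ^ q * 2 ^ ((d : ℝ) / 2) * x ^ (-((d : ℝ) / 2)) * (x ^ e / (r - 1)) := by gcongr
    _ = _ := by ring

theorem Wp_det {d : ℕ} (K : Set (EuclideanSpace ℝ (Fin d)))
    (L : ℝ) (f : ℕ → EuclideanSpace ℝ (Fin d) → (Fin d → ℕ)) (hL : 0 ≤ L)
    (hf : ∀ k, Measurable (f k))
    (hS : ∀ k x, f k x ∈ Fintype.piFinset fun _ : Fin d => Finset.range (2 ^ k))
    (h0 : ∀ x y, f 0 x = f 0 y) (hn : ∀ k x y, f (k + 1) x = f (k + 1) y → f k x = f k y)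
    (hD : ∀ k, ∀ x ∈ K, ∀ y ∈ K, f k x = f k y → dist x y ≤ L / 2 ^ k)
    (p : ℝ≥0∞) (hp : 1 ≤ p) (hpt : p ≠ ⊤)
    (μ ν : Measure (EuclideanSpace ℝ (Fin d))) [IsProbabilityMeasure μ] [IsProbabilityMeasure ν]
    (hμ : μ Kᶜ = 0) (hν : ν Kᶜ = 0) (m : ℕ) :
    Wp p μ ν ≤ ENNReal.ofReal (((L / 2 ^ m) ^ p.toReal + ∑ k ∈ Finset.range m, (L / 2 ^ k) ^ p.toReal *
      ∑ i ∈ Fintype.piFinset fun _ : Fin d => Finset.range (2 ^ (k + 1)),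
        |μ.real (f (k + 1) ⁻¹' {i}) - ν.real (f (k + 1) ⁻¹' {i})|) ^ (1 / p.toReal)) := by
  classical
  have hp0 : p ≠ 0 := (zero_lt_one.trans_le hp).ne'
  have hpp : 0 < p.toReal := ENNReal.toReal_pos hp0 hpt
  set q := p.toReal with hq
  obtain ⟨π, h1, h2, h3⟩ := transport_lem f hf
    (fun k => Fintype.piFinset fun _ : Fin d => Finset.range (2 ^ k)) hS h0 hn
    (fun z => if z.1 ∈ K ∧ z.2 ∈ K then ‖dist z.1 z.2‖ₑ ^ q else 0)
    (fun k => ENNReal.ofReal ((L / 2 ^ k) ^ q))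
    (by
      intro k x y hxy
      simp only
      split_ifs with hK
      · have := hD k x hK.1 y hK.2 hxy
        rw [Real.enorm_eq_ofReal dist_nonneg, ENNReal.ofReal_rpow_of_nonneg dist_nonneg hpp.le]
        gcongr
      · exact bot_le) m μ ν (by simp)
  have hnn : ∀ k : ℕ, 0 ≤ (L / 2 ^ k) ^ q := fun k => Real.rpow_nonneg (by positivity) _
  have hsum0 : 0 ≤ ((L / 2 ^ m) ^ q + ∑ k ∈ Finset.range m, (L / 2 ^ k) ^ q *
      ∑ i ∈ Fintype.piFinset fun _ : Fin d => Finset.range (2 ^ (k + 1)),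
        |μ.real (f (k + 1) ⁻¹' {i}) - ν.real (f (k + 1) ⁻¹' {i})|) :=
    add_nonneg (hnn m) (Finset.sum_nonneg fun k _ => mul_nonneg (hnn k)
      (Finset.sum_nonneg fun i _ => abs_nonneg _))
  have hW : Wp p μ ν ≤ eLpNorm (fun z : _ × _ => dist z.1 z.2) p π := by
    unfold Wp
    exact iInf₂_le π ⟨h1, h2⟩
  refine hW.trans ?_
  rw [eLpNorm_eq_lintegral_rpow_enorm_toReal hp0 hpt,
    ← ENNReal.ofReal_rpow_of_nonneg hsum0 (by positivity)]
  gcongr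
  have hae : ∀ᵐ z ∂π, z.1 ∈ K ∧ z.2 ∈ K := by
    have e1 : ∀ᵐ x ∂(π.map Prod.fst), x ∈ K := by rw [h1]; exact hμ
    have e2 : ∀ᵐ x ∂(π.map Prod.snd), x ∈ K := by rw [h2]; exact hν
    filter_upwards [ae_of_ae_map measurable_fst.aemeasurable e1,
        ae_of_ae_map measurable_snd.aemeasurable e2] with z a b
    exact ⟨a, b⟩
  calc _ = ∫⁻ z, (if z.1 ∈ K ∧ z.2 ∈ K then ‖dist z.1 z.2‖ₑ ^ q else 0) ∂π := by
        apply lintegral_congr_ae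
        filter_upwards [hae] with z hz
        rw [if_pos hz]
    _ ≤ _ := h3
    _ ≤ _ := by
      rw [measure_univ, mul_one, ENNReal.ofReal_add (hnn m) (Finset.sum_nonneg fun k _ =>
        mul_nonneg (hnn k) (Finset.sum_nonneg fun i _ => abs_nonneg _)),
        ENNReal.ofReal_sum_of_nonneg fun k _ =>
        mul_nonneg (hnn k) (Finset.sum_nonneg fun i _ => abs_nonneg _)]
      refine add_le_add le_rfl (Finset.sum_le_sum fun k _ => ?_)
      rw [ENNReal.ofReal_mul (hnn k), ENNReal.ofReal_sum_of_nonneg fun i _ => abs_nonneg _]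
      refine mul_le_mul' le_rfl (Finset.sum_le_sum fun i _ => ?_)
      rw [← ENNReal.ofReal_toReal (measure_ne_top μ (f (k + 1) ⁻¹' {i})),
        ← ENNReal.ofReal_toReal (measure_ne_top ν (f (k + 1) ⁻¹' {i})),
        ← ENNReal.ofReal_sub _ ENNReal.toReal_nonneg]
      exact ENNReal.ofReal_le_ofReal (le_abs_self _)

theorem RWp_le_Wp {E : Type*} [MetricSpace E] [MeasurableSpace E] (p : ℝ≥0∞) (ε : ℝ)
    (μ ν : Measure E) [IsProbabilityMeasure μ] [IsProbabilityMeasure ν] :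
    RWp p ε μ ν ≤ Wp p μ ν := by
  unfold RWp
  refine (iInf₂_le μ ν).trans <| (iInf₂_le le_rfl le_rfl).trans <|
    (iInf₂_le (by simp) (by simp)).trans ?_
  simp

theorem rpow_aux (B t q : ℝ) (hB : 0 ≤ B) (ht : 0 < t) (hq : 1 ≤ q) :
    B ^ (1 / q) ≤ t * (1 + B / t ^ q) := by
  have hq0 : 0 < q := by linarith
  have htq : 0 < t ^ q := Real.rpow_pos_of_pos ht _
  set u := B / t ^ q with hu
  have hu0 : 0 ≤ u := by positivity
  have hBu : B = t ^ q * u := by rw [hu]; field_simp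
  rw [hBu, Real.mul_rpow htq.le hu0, ← Real.rpow_mul ht.le, mul_one_div_cancel hq0.ne',
    Real.rpow_one]
  gcongr
  rcases le_total u 1 with h | h
  · have := Real.rpow_le_one hu0 h (show 0 ≤ 1 / q by positivity)
    linarith
  · have : u ^ (1 / q) ≤ u ^ (1 : ℝ) :=
      Real.rpow_le_rpow_of_exponent_le h (by rw [div_le_one hq0]; exact hq)
    rw [Real.rpow_one] at this
    linarith

theorem sum_sqrt_lem {E ι : Type*} [MeasurableSpace E] [MeasurableSpace ι]
    [MeasurableSingletonClass ι] (μ : Measure E) [IsProbabilityMeasure μ]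
    (f : E → ι) (hf : Measurable f) (S : Finset ι) (n : ℝ) (hn : 0 < n) :
    ∑ i ∈ S, √(μ.real (f ⁻¹' {i}) / n) ≤ √((S.card : ℝ) / n) := by
  have hs : ∑ i ∈ S, μ.real (f ⁻¹' {i}) ≤ 1 := by
    rw [sum_measureReal_preimage_singleton S (fun i _ => hf (measurableSet_singleton i))]
    exact measureReal_le_one
  apply Real.le_sqrt_of_sq_le
  refine (sq_sum_le_card_mul_sum_sq).trans ?_
  have : ∑ i ∈ S, √(μ.real (f ⁻¹' {i}) / n) ^ 2 = (∑ i ∈ S, μ.real (f ⁻¹' {i})) / n := by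
    rw [Finset.sum_div]
    exact Finset.sum_congr rfl fun i _ => Real.sq_sqrt (div_nonneg measureReal_nonneg hn.le)
  rw [this, mul_div_assoc']
  gcongr
  nlinarith [(Nat.cast_nonneg S.card : (0 : ℝ) ≤ S.card)]

theorem upper_lem (d : ℕ) (hd : 2 < d) (K : Set (EuclideanSpace ℝ (Fin d))) (hK : IsCompact K)
    (p : ℝ≥0∞) (hp : 1 ≤ p) (μ : Measure (EuclideanSpace ℝ (Fin d))) [IsProbabilityMeasure μ]
    (hμ : μ Kᶜ = 0) (hpt : p ≠ ⊤) (hpd : p.toReal < (d : ℝ) / 2) :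
    ∃ C : ℝ, ∀ ε : ℝ, 0 ≤ ε → ε ≤ 1 / 2 → ∀ n : ℕ, 0 < n →
      ∫ ω, (RWp p ε μ (empMeas n ω)).toReal ∂(Measure.pi fun _ : Fin n => μ)
        ≤ C * (n : ℝ) ^ (-(1 / (d : ℝ))) := by
  obtain ⟨L, f, hL, hf, hS, h0, hn, hD⟩ := grid_lem d K hK
  have hq1 : 1 ≤ p.toReal := by
    rw [← ENNReal.toReal_one]; exact ENNReal.toReal_mono hpt hp
  obtain ⟨C0, hC0, hC⟩ := analytic_lem d hd p.toReal L hq1 hpd hL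
  refine ⟨1 + C0, fun ε _ _ n hnpos => ?_⟩
  obtain ⟨m, hm⟩ := hC n hnpos
  have hn0 : (0 : ℝ) < n := by exact_mod_cast hnpos
  set q := p.toReal with hq
  set t : ℝ := (n : ℝ) ^ (-(1 / (d : ℝ))) with ht
  have ht0 : 0 < t := Real.rpow_pos_of_pos hn0 _
  have htq : 0 < t ^ q := Real.rpow_pos_of_pos ht0 _
  set P : Measure (Fin n → EuclideanSpace ℝ (Fin d)) := Measure.pi fun _ : Fin n => μ with hP
  have hnn : ∀ k : ℕ, 0 ≤ (L / 2 ^ k) ^ q := fun k => Real.rpow_nonneg (by positivity) _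
  let B : (Fin n → EuclideanSpace ℝ (Fin d)) → ℝ := fun ω =>
    (L / 2 ^ m) ^ q + ∑ k ∈ Finset.range m, (L / 2 ^ k) ^ q *
      ∑ i ∈ Fintype.piFinset fun _ : Fin d => Finset.range (2 ^ (k + 1)),
        |μ.real (f (k + 1) ⁻¹' {i}) - (empMeas n ω).real (f (k + 1) ⁻¹' {i})|
  have hB0 : ∀ ω, 0 ≤ B ω := fun ω =>
    add_nonneg (hnn m) (Finset.sum_nonneg fun k _ => mul_nonneg (hnn k)
      (Finset.sum_nonneg fun i _ => abs_nonneg _))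
  have hdev := fun k i => dev_lem μ n hnpos (f k ⁻¹' {i}) (hf k (measurableSet_singleton i))
  have hint1 : ∀ k : ℕ, Integrable (fun ω => (L / 2 ^ k) ^ q *
      ∑ i ∈ Fintype.piFinset fun _ : Fin d => Finset.range (2 ^ (k + 1)),
        |μ.real (f (k + 1) ⁻¹' {i}) - (empMeas n ω).real (f (k + 1) ⁻¹' {i})|) P := fun k =>
    (integrable_finsetSum _ fun i _ => (hdev (k + 1) i).1).const_mul _
  have hint2 : Integrable (fun ω => ∑ k ∈ Finset.range m, (L / 2 ^ k) ^ q *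
      ∑ i ∈ Fintype.piFinset fun _ : Fin d => Finset.range (2 ^ (k + 1)),
        |μ.real (f (k + 1) ⁻¹' {i}) - (empMeas n ω).real (f (k + 1) ⁻¹' {i})|) P :=
    integrable_finsetSum _ fun k _ => hint1 k
  have hBint : Integrable B P := (integrable_const _).add hint2
  have hBle : ∫ ω, B ω ∂P ≤ C0 * t ^ q := by
    refine le_trans ?_ hm
    change ∫ ω, ((L / 2 ^ m) ^ q + ∑ k ∈ Finset.range m, (L / 2 ^ k) ^ q *
      ∑ i ∈ Fintype.piFinset fun _ : Fin d => Finset.range (2 ^ (k + 1)),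
        |μ.real (f (k + 1) ⁻¹' {i}) - (empMeas n ω).real (f (k + 1) ⁻¹' {i})|) ∂P ≤ _
    rw [integral_add (integrable_const _) hint2, integral_finsetSum _ fun k _ => hint1 k]
    refine add_le_add (by simp) (Finset.sum_le_sum fun k _ => ?_)
    rw [integral_const_mul, integral_finsetSum _ fun i _ => (hdev (k + 1) i).1]
    refine mul_le_mul_of_nonneg_left ?_ (hnn k)
    refine (Finset.sum_le_sum fun i _ => (hdev (k + 1) i).2).trans ?_
    refine (sum_sqrt_lem μ (f (k + 1)) (hf _) _ n hn0).trans (le_of_eq ?_)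
    simp
  have hae : ∀ᵐ ω ∂P, ∀ i, ω i ∈ K := by
    rw [ae_all_iff]
    intro i
    have hmp := measurePreserving_eval (fun _ : Fin n => μ) i
    exact hmp.quasiMeasurePreserving.ae (p := fun x => x ∈ K) hμ
  have hbound : ∀ᵐ ω ∂P, (RWp p ε μ (empMeas n ω)).toReal ≤ t * (1 + B ω / t ^ q) := by
    filter_upwards [hae] with ω hω
    have := empMeas_prob n hnpos ω
    have hν : empMeas n ω Kᶜ = 0 := by
      unfold empMeas
      rw [Measure.smul_apply, Measure.finsetSum_apply]
      have : ∀ i, Measure.dirac (ω i) Kᶜ = 0 := by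
        intro i
        rw [Measure.dirac_apply' _ hK.isClosed.measurableSet.compl]
        simp [hω i]
      simp [this]
    have h1 := Wp_det K L f hL hf hS h0 hn hD p hp hpt μ (empMeas n ω) hμ hν m
    refine le_trans ?_ (rpow_aux (B ω) t q (hB0 ω) ht0 hq1)
    exact ENNReal.toReal_le_of_le_ofReal (Real.rpow_nonneg (hB0 ω) _)
      ((RWp_le_Wp p ε μ _).trans h1)
  calc _ ≤ ∫ ω, t * (1 + B ω / t ^ q) ∂P :=
        integral_mono_of_nonneg (ae_of_all _ fun ω => ENNReal.toReal_nonneg)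
          (((integrable_const _).add (hBint.div_const _)).const_mul _) hbound
    _ = t * (1 + (∫ ω, B ω ∂P) / t ^ q) := by
        rw [integral_const_mul, integral_add (integrable_const _) (hBint.div_const _),
          integral_div]
        simp
    _ ≤ t * (1 + C0) := by
        gcongr
        rw [div_le_iff₀ htq]; exact hBle
    _ = _ := by ring

/-- one-sample rates: for compact `K ⊂ ℝ^d`, `d > 2`, `ε ∈ [0,1/2]`:
if `p < d/2` then `E[W_p^ε(μ, μ̂_n)] ≤ C n^{−1/d}` with `C` independent of `n` and `ε`;
and if `d_*^τ(μ) > s` for some `τ ∈ (ε,1]`, then `W_p^ε(μ,γ) ≥ C'(τ−ε)^{1/p} n^{−1/s}`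
for all `γ` supported on at most `n` points, with `C' > 0` an absolute constant. -/
theorem RWp_one_sample_rates :
    ∃ C' : ℝ, 0 < C' ∧
      ∀ (d : ℕ), 2 < d →
      ∀ (K : Set (EuclideanSpace ℝ (Fin d))), IsCompact K →
      ∀ (p : ℝ≥0∞), 1 ≤ p →
      ∀ (μ : Measure (EuclideanSpace ℝ (Fin d))), IsProbabilityMeasure μ → μ Kᶜ = 0 →
        ((p ≠ ⊤ → p.toReal < (d : ℝ) / 2 →
          ∃ C : ℝ, ∀ ε : ℝ, 0 ≤ ε → ε ≤ 1 / 2 → ∀ n : ℕ, 0 < n →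
            ∫ ω, (RWp p ε μ (empMeas n ω)).toReal ∂(Measure.pi fun _ : Fin n => μ)
              ≤ C * (n : ℝ) ^ (-(1 / (d : ℝ)))) ∧
        (∀ ε τ s : ℝ, 0 ≤ ε → ε ≤ 1 / 2 → ε < τ → τ ≤ 1 → 0 < s → s < lowerDim K τ μ →
          ∃ N : ℕ, ∀ n : ℕ, N ≤ n →
          ∀ γ : Measure (EuclideanSpace ℝ (Fin d)), IsProbabilityMeasure γ →
            (∃ F : Finset (EuclideanSpace ℝ (Fin d)), F.card ≤ n ∧ γ (↑F : Set _)ᶜ = 0) →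
            ENNReal.ofReal (C' * (τ - ε) ^ (1 / p.toReal) * (n : ℝ) ^ (-(1 / s)))
              ≤ RWp p ε μ γ)) := by
  refine ⟨1, one_pos, fun d hd K hK p hp μ hμp hμ => ⟨fun hpt hpd => ?_, ?_⟩⟩
  · exact upper_lem d hd K hK p hp μ hμ hpt hpd
  · intro ε τ s hε _ hετ _ hs hsd
    exact lower_lem p hp K μ ε τ s hε hετ hs hsd

end
end
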